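/- arXiv:1602.00473 — 2 statements merged into one kernel-verified Lean document; each statement's English description precedes it below -/
import Mathlib

section
/- Let X be a Banach space. A function f : [0,1] → X is Birkhoff integrable if and only if it is ℋ-integrable (i.e. Henstock integrable with respect to Lebesgue-measurable gauges) and Pettis integrable. -/
open Set Metric MeasureTheory Pointwise
open scoped ENNReal NNReal

namespace GaugePaper

variable (X : Type*) [NormedAddCommGroup X] [NormedSpace ℝ X]

/-- `A ∈ cwk(X)`: `A` is a nonempty, convex and weakly compact subset of `X`. -/
def IsCWK (A : Set X) : Prop :=
  A.Nonempty ∧ Convex ℝ A ∧ IsCompact (toWeakSpace ℝ X '' A)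

variable {X}

/-- The support function `σ(x*, A)`. -/
noncomputable def suppFn (x' : X →L[ℝ] ℝ) (A : Set X) : ℝ := sSup (x' '' A)

/-- `‖A‖ = sup {‖x‖ : x ∈ A}`. -/
noncomputable def setNorm (A : Set X) : ℝ := sSup ((fun x => ‖x‖) '' A)

/-- A gauge on `[0,1]`: a positive function. -/
def IsGauge (δ : ℝ → ℝ) : Prop := ∀ t ∈ Icc (0:ℝ) 1, 0 < δ t

/-- A tagged partition of `[0,1]` into `n` (possibly degenerate) nonoverlapping closed
subintervals `[pt i, pt (i+1)]`, with tags `tag i ∈ [0,1]`. -/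
structure TP (n : ℕ) where
  pt : Fin (n + 1) → ℝ
  tag : Fin n → ℝ
  mono : Monotone pt
  first : pt 0 = 0
  last : pt (Fin.last n) = 1
  tagMem : ∀ i, tag i ∈ Icc (0:ℝ) 1

namespace TP

variable {n : ℕ} (P : TP n)

/-- The `i`-th subinterval of the partition. -/
def ivl (i : Fin n) : Set ℝ := Icc (P.pt i.castSucc) (P.pt i.succ)

/-- The length `|I_i|` of the `i`-th subinterval. -/
def len (i : Fin n) : ℝ := P.pt i.succ - P.pt i.castSucc

/-- A Perron (Henstock) partition: each tag belongs to its interval. -/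
def IsPerron : Prop := ∀ i, P.tag i ∈ P.ivl i

/-- `δ`-fineness: `I_i ⊆ (t_i - δ(t_i), t_i + δ(t_i))`. -/
def IsFine (δ : ℝ → ℝ) : Prop :=
  ∀ i, P.ivl i ⊆ Ioo (P.tag i - δ (P.tag i)) (P.tag i + δ (P.tag i))

/-- An interior Henstock partition: each tag is in the interior of its interval, except
possibly for intervals containing `0` or `1`, where the tag may also be `0` or `1`. -/
def IsInterior : Prop :=
  ∀ i, P.tag i ∈ Ioo (P.pt i.castSucc) (P.pt i.succ) ∨
    (((0:ℝ) ∈ P.ivl i ∨ (1:ℝ) ∈ P.ivl i) ∧ P.tag i ∈ P.ivl i ∩ ({0, 1} : Set ℝ))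

end TP

/-- Riemann sum of a multifunction: `∑ i |I_i| • Γ(t_i)` (Minkowski sums). -/
def mSum {n : ℕ} (P : TP n) (Γ : ℝ → Set X) : Set X :=
  ∑ i : Fin n, P.len i • Γ (P.tag i)

/-- Riemann sum of a function: `∑ i |I_i| • f(t_i)`. -/
def fSum {n : ℕ} (P : TP n) (f : ℝ → X) : X :=
  ∑ i : Fin n, P.len i • f (P.tag i)

/-! ### Gauge integrals of multifunctions -/

/-- Henstock integrability of a multifunction `Γ : [0,1] → cwk(X)`. -/
def HenstockIntegrable (Γ : ℝ → Set X) : Prop :=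
  ∃ I : Set X, IsCWK X I ∧ ∀ ε > 0, ∃ δ : ℝ → ℝ, IsGauge δ ∧
    ∀ (n : ℕ) (P : TP n), P.IsPerron → P.IsFine δ → hausdorffDist I (mSum P Γ) < ε

/-- McShane integrability of a multifunction (free tags). -/
def McShaneIntegrable (Γ : ℝ → Set X) : Prop :=
  ∃ I : Set X, IsCWK X I ∧ ∀ ε > 0, ∃ δ : ℝ → ℝ, IsGauge δ ∧
    ∀ (n : ℕ) (P : TP n), P.IsFine δ → hausdorffDist I (mSum P Γ) < ε

/-- `ℋ`-integrability: Henstock integrability with Lebesgue measurable gauges. -/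
def HMeasIntegrable (Γ : ℝ → Set X) : Prop :=
  ∃ I : Set X, IsCWK X I ∧ ∀ ε > 0, ∃ δ : ℝ → ℝ, IsGauge δ ∧ AEMeasurable δ volume ∧
    ∀ (n : ℕ) (P : TP n), P.IsPerron → P.IsFine δ → hausdorffDist I (mSum P Γ) < ε

/-- Birkhoff (`ℳ`-) integrability: McShane integrability with Lebesgue measurable gauges. -/
def BirkhoffIntegrable (Γ : ℝ → Set X) : Prop :=
  ∃ I : Set X, IsCWK X I ∧ ∀ ε > 0, ∃ δ : ℝ → ℝ, IsGauge δ ∧ AEMeasurable δ volume ∧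
    ∀ (n : ℕ) (P : TP n), P.IsFine δ → hausdorffDist I (mSum P Γ) < ε

/-! ### Gauge integrals of (single-valued) functions -/

/-- Henstock integrability of a function `f : [0,1] → X`. -/
def FHenstockIntegrable (f : ℝ → X) : Prop :=
  ∃ w : X, ∀ ε > 0, ∃ δ : ℝ → ℝ, IsGauge δ ∧
    ∀ (n : ℕ) (P : TP n), P.IsPerron → P.IsFine δ → ‖w - fSum P f‖ < ε

/-- McShane integrability of a function. -/
def FMcShaneIntegrable (f : ℝ → X) : Prop :=
  ∃ w : X, ∀ ε > 0, ∃ δ : ℝ → ℝ, IsGauge δ ∧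
    ∀ (n : ℕ) (P : TP n), P.IsFine δ → ‖w - fSum P f‖ < ε

/-- `ℋ`-integrability of a function: measurable gauges. -/
def FHMeasIntegrable (f : ℝ → X) : Prop :=
  ∃ w : X, ∀ ε > 0, ∃ δ : ℝ → ℝ, IsGauge δ ∧ AEMeasurable δ volume ∧
    ∀ (n : ℕ) (P : TP n), P.IsPerron → P.IsFine δ → ‖w - fSum P f‖ < ε

/-- Birkhoff (`ℳ`-) integrability of a function: McShane with measurable gauges. -/
def FBirkhoffIntegrable (f : ℝ → X) : Prop :=
  ∃ w : X, ∀ ε > 0, ∃ δ : ℝ → ℝ, IsGauge δ ∧ AEMeasurable δ volume ∧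
    ∀ (n : ℕ) (P : TP n), P.IsFine δ → ‖w - fSum P f‖ < ε

/-- Henstock–Kurzweil integrability of a real-valued function on `[0,1]`. -/
def HKIntegrable (g : ℝ → ℝ) : Prop :=
  ∃ A : ℝ, ∀ ε > 0, ∃ δ : ℝ → ℝ, IsGauge δ ∧
    ∀ (n : ℕ) (P : TP n), P.IsPerron → P.IsFine δ → |fSum P g - A| < ε

/-! ### Pettis integrals -/

/-- Pettis integrability of a function `f : [0,1] → X`. -/
def FPettisIntegrable (f : ℝ → X) : Prop :=
  (∀ x' : X →L[ℝ] ℝ, IntegrableOn (fun t => x' (f t)) (Icc (0:ℝ) 1) volume) ∧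
  ∀ E ⊆ Icc (0:ℝ) 1, NullMeasurableSet E volume →
    ∃ ν : X, ∀ x' : X →L[ℝ] ℝ, x' ν = ∫ t in E, x' (f t)

/-- Pettis integrability of a multifunction `Γ : [0,1] → cwk(X)`. -/
def PettisIntegrable (Γ : ℝ → Set X) : Prop :=
  (∀ x' : X →L[ℝ] ℝ, IntegrableOn (fun t => suppFn x' (Γ t)) (Icc (0:ℝ) 1) volume) ∧
  ∀ E ⊆ Icc (0:ℝ) 1, NullMeasurableSet E volume →
    ∃ W : Set X, IsCWK X W ∧ ∀ x' : X →L[ℝ] ℝ, suppFn x' W = ∫ t in E, suppFn x' (Γ t)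

/-- `f` is a selection of `Γ`. -/
def Selection (Γ : ℝ → Set X) (f : ℝ → X) : Prop := ∀ t ∈ Icc (0:ℝ) 1, f t ∈ Γ t

/-! ### Variational integrals -/

/-- Finite additivity of an interval multifunction on subintervals of `[0,1]`
(an interval `[a,b] ⊆ [0,1]` is encoded by its endpoints). -/
def AdditiveIntervalMF (Φ : ℝ → ℝ → Set X) : Prop :=
  ∀ a b c : ℝ, 0 ≤ a → a ≤ b → b ≤ c → c ≤ 1 → Φ a c = Φ a b + Φ b c

/-- Finite additivity of a vector-valued interval function on subintervals of `[0,1]`. -/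
def AdditiveIntervalF (Φ : ℝ → ℝ → X) : Prop :=
  ∀ a b c : ℝ, 0 ≤ a → a ≤ b → b ≤ c → c ≤ 1 → Φ a c = Φ a b + Φ b c

/-- `Φ` is a variational Henstock primitive of the multifunction `Γ`. -/
def vHPrimitive (Γ : ℝ → Set X) (Φ : ℝ → ℝ → Set X) : Prop :=
  (∀ a b : ℝ, 0 ≤ a → a ≤ b → b ≤ 1 → IsCWK X (Φ a b)) ∧ AdditiveIntervalMF Φ ∧
  ∀ ε > 0, ∃ δ : ℝ → ℝ, IsGauge δ ∧ ∀ (n : ℕ) (P : TP n), P.IsPerron → P.IsFine δ →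
    ∑ i : Fin n, hausdorffDist (Φ (P.pt i.castSucc) (P.pt i.succ)) (P.len i • Γ (P.tag i)) < ε

/-- Variational Henstock integrability of a multifunction. -/
def vHIntegrable (Γ : ℝ → Set X) : Prop := ∃ Φ : ℝ → ℝ → Set X, vHPrimitive Γ Φ

/-- Variational McShane integrability of a multifunction (free tags). -/
def vMSIntegrable (Γ : ℝ → Set X) : Prop :=
  ∃ Φ : ℝ → ℝ → Set X,
    (∀ a b : ℝ, 0 ≤ a → a ≤ b → b ≤ 1 → IsCWK X (Φ a b)) ∧ AdditiveIntervalMF Φ ∧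
    ∀ ε > 0, ∃ δ : ℝ → ℝ, IsGauge δ ∧ ∀ (n : ℕ) (P : TP n), P.IsFine δ →
      ∑ i : Fin n, hausdorffDist (Φ (P.pt i.castSucc) (P.pt i.succ)) (P.len i • Γ (P.tag i)) < ε

/-- Variational `ℋ`-integrability of a multifunction: measurable gauges. -/
def vHMeasIntegrable (Γ : ℝ → Set X) : Prop :=
  ∃ Φ : ℝ → ℝ → Set X,
    (∀ a b : ℝ, 0 ≤ a → a ≤ b → b ≤ 1 → IsCWK X (Φ a b)) ∧ AdditiveIntervalMF Φ ∧
    ∀ ε > 0, ∃ δ : ℝ → ℝ, IsGauge δ ∧ AEMeasurable δ volume ∧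
      ∀ (n : ℕ) (P : TP n), P.IsPerron → P.IsFine δ →
        ∑ i : Fin n, hausdorffDist (Φ (P.pt i.castSucc) (P.pt i.succ)) (P.len i • Γ (P.tag i)) < ε

/-- `Φ` is a variational Henstock primitive of the function `f`. -/
def FvHPrimitive (f : ℝ → X) (Φ : ℝ → ℝ → X) : Prop :=
  AdditiveIntervalF Φ ∧
  ∀ ε > 0, ∃ δ : ℝ → ℝ, IsGauge δ ∧ ∀ (n : ℕ) (P : TP n), P.IsPerron → P.IsFine δ →
    ∑ i : Fin n, ‖Φ (P.pt i.castSucc) (P.pt i.succ) - P.len i • f (P.tag i)‖ < ε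

/-- Variational Henstock integrability of a function. -/
def FvHIntegrable (f : ℝ → X) : Prop := ∃ Φ : ℝ → ℝ → X, FvHPrimitive f Φ

/-- Variational McShane integrability of a function (free tags). -/
def FvMSIntegrable (f : ℝ → X) : Prop :=
  ∃ Φ : ℝ → ℝ → X, AdditiveIntervalF Φ ∧
    ∀ ε > 0, ∃ δ : ℝ → ℝ, IsGauge δ ∧ ∀ (n : ℕ) (P : TP n), P.IsFine δ →
      ∑ i : Fin n, ‖Φ (P.pt i.castSucc) (P.pt i.succ) - P.len i • f (P.tag i)‖ < ε

/-- Variational `ℋ`-integrability of a function: measurable gauges. -/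
def FvHMeasIntegrable (f : ℝ → X) : Prop :=
  ∃ Φ : ℝ → ℝ → X, AdditiveIntervalF Φ ∧
    ∀ ε > 0, ∃ δ : ℝ → ℝ, IsGauge δ ∧ AEMeasurable δ volume ∧
      ∀ (n : ℕ) (P : TP n), P.IsPerron → P.IsFine δ →
        ∑ i : Fin n, ‖Φ (P.pt i.castSucc) (P.pt i.succ) - P.len i • f (P.tag i)‖ < ε

/-! ### Partial Perron partitions and variational measures -/

/-- A finite tagged Perron family of `n` nonoverlapping closed subintervals
`[a i, b i]` of `[0,1]` (a "partition in `[0,1]`", not necessarily covering it). -/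
structure PTP (n : ℕ) where
  a : Fin n → ℝ
  b : Fin n → ℝ
  tag : Fin n → ℝ
  le : ∀ i, a i ≤ b i
  sub : ∀ i, Icc (a i) (b i) ⊆ Icc (0:ℝ) 1
  nonoverlap : ∀ i j, i ≠ j → (Icc (a i) (b i) ∩ Icc (a j) (b j)).Subsingleton
  perron : ∀ i, tag i ∈ Icc (a i) (b i)

/-- `δ`-fineness of a partial Perron family. -/
def PTP.IsFine {n : ℕ} (P : PTP n) (δ : ℝ → ℝ) : Prop :=
  ∀ i, Icc (P.a i) (P.b i) ⊆ Ioo (P.tag i - δ (P.tag i)) (P.tag i + δ (P.tag i))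

/-- `Var(Ψ, δ, E)` for a scalar interval function `Ψ`. -/
noncomputable def scVar (Ψ : ℝ → ℝ → ℝ) (δ : ℝ → ℝ) (E : Set ℝ) : ℝ≥0∞ :=
  ⨆ (n : ℕ) (P : PTP n) (_ : P.IsFine δ ∧ ∀ i, P.tag i ∈ E),
    ∑ i : Fin n, ENNReal.ofReal |Ψ (P.a i) (P.b i)|

/-- The variational measure `V_Ψ(E)` generated by a scalar interval function `Ψ`. -/
noncomputable def scVarMeasure (Ψ : ℝ → ℝ → ℝ) (E : Set ℝ) : ℝ≥0∞ :=
  ⨅ (δ : ℝ → ℝ) (_ : IsGauge δ), scVar Ψ δ E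


open Filter Topology
open scoped symmDiff

/-! ### Uniform absolute continuity of Pettis integrals -/

/-- Measurable sets with the distance `μ (s ∆ t)` form a complete space. -/
instance measuredSets_completeSpace {α : Type*} [MeasurableSpace α] (μ : Measure α) :
    CompleteSpace (MeasuredSets μ) := by
  have hB : ∀ n : ℕ, (0 : ℝ≥0∞) < 2⁻¹ ^ n := fun n => ENNReal.pow_pos (by simp) n
  refine EMetric.complete_of_convergent_controlled_sequences (fun n => 2⁻¹ ^ n) hB fun u hu => ?_
  have hm : ∀ n, MeasurableSet (u n : Set α) := fun n => (u n).2
  let v : MeasuredSets μ := ⟨⋂ n, ⋃ m, (u (n + m) : Set α),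
    MeasurableSet.iInter fun n => MeasurableSet.iUnion fun m => hm _⟩
  refine ⟨v, tendsto_iff_edist_tendsto_0.2 ?_⟩
  have hsub : ∀ n, (u n : Set α) ∆ v ⊆ ⋃ k, (u (n + k) : Set α) ∆ u (n + k + 1) := by
    intro n x hx
    by_contra hcon
    simp only [mem_iUnion, not_exists] at hcon
    have hstep : ∀ k, (x ∈ (u (n + k) : Set α) ↔ x ∈ (u n : Set α)) := by
      intro k
      induction k with
      | zero => simp
      | succ k ih =>
        rw [← ih]
        have := hcon k
        rw [mem_symmDiff] at this
        rw [← add_assoc]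
        tauto
    have hv : x ∈ (v : Set α) ↔ x ∈ (u n : Set α) := by
      change x ∈ ⋂ n, ⋃ m, (u (n + m) : Set α) ↔ _
      simp only [mem_iInter, mem_iUnion]
      constructor
      · intro h
        obtain ⟨m, hm⟩ := h n
        exact (hstep m).1 hm
      · intro h i
        refine ⟨n, ?_⟩
        rw [add_comm]
        exact (hstep i).2 h
    rw [mem_symmDiff] at hx
    tauto
  have hle : ∀ n, edist (u n) v ≤ 2 * 2⁻¹ ^ n := by
    intro n
    calc edist (u n) v = μ ((u n : Set α) ∆ v) := rfl
      _ ≤ ∑' k, μ ((u (n + k) : Set α) ∆ u (n + k + 1)) :=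
        (measure_mono (hsub n)).trans (measure_iUnion_le _)
      _ ≤ ∑' k : ℕ, (2⁻¹ : ℝ≥0∞) ^ (n + k) :=
        ENNReal.tsum_le_tsum fun k => (hu (n + k) _ _ le_rfl (Nat.le_succ _)).le
      _ = 2 * 2⁻¹ ^ n := by
        simp_rw [pow_add]
        rw [ENNReal.tsum_mul_left, ENNReal.tsum_geometric, ENNReal.one_sub_inv_two, inv_inv,
          mul_comm]
  refine tendsto_of_tendsto_of_tendsto_of_le_of_le tendsto_const_nhds ?_ (fun _ => zero_le) hle
  have := ENNReal.Tendsto.const_mul (a := 2)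
    (ENNReal.tendsto_pow_atTop_nhds_zero_of_lt_one (r := 2⁻¹) (by simp)) (by simp)
  simpa using this

/-- The indefinite integral of an integrable function is continuous on measured sets. -/
lemma continuous_setIntegral_measuredSets {α : Type*} [MeasurableSpace α] {μ : Measure α}
    {g : α → ℝ} (hg : Integrable g μ) :
    Continuous fun E : MeasuredSets μ => ∫ t in (E : Set α), g t ∂μ := by
  refine continuous_iff_continuousAt.2 fun E => ?_
  have hd : ∀ F : MeasuredSets μ, ‖∫ t in (F : Set α), g t ∂μ - ∫ t in (E : Set α), g t ∂μ‖ ≤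
      ∫ t in (F : Set α) ∆ E, |g t| ∂μ := by
    intro F
    have mF : MeasurableSet (F : Set α) := F.2
    have mE : MeasurableSet (E : Set α) := E.2
    rw [← integral_indicator mF, ← integral_indicator mE,
      ← integral_sub (hg.indicator mF) (hg.indicator mE),
      ← integral_indicator (mF.symmDiff mE)]
    refine (norm_integral_le_integral_norm _).trans_eq (integral_congr_ae (.of_forall fun t => ?_))
    change ‖(F : Set α).indicator g t - (E : Set α).indicator g t‖ =
      ((F : Set α) ∆ E).indicator (fun t => |g t|) t
    by_cases h1 : t ∈ (F : Set α) <;> by_cases h2 : t ∈ (E : Set α) <;>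
      simp [h1, h2, mem_symmDiff]
  refine tendsto_iff_norm_sub_tendsto_zero.2 (squeeze_zero (fun _ => norm_nonneg _) hd ?_)
  refine hg.abs.tendsto_setIntegral_nhds_zero ?_
  have : Tendsto (fun F : MeasuredSets μ => edist F E) (𝓝 E) (𝓝 0) := by
    have h := (Continuous.edist (β := MeasuredSets μ) continuous_id
      (continuous_const (y := E))).tendsto E
    simpa using h
  exact this

lemma eq_zero_of_setIntegral_Ioo_rat {μ : Measure ℝ} {g : ℝ → ℝ} (hg : Integrable g μ)
    (h : ∀ a b : ℚ, ∫ t in Ioo (a : ℝ) b, g t ∂μ = 0) {E : Set ℝ} (hE : MeasurableSet E) :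
    ∫ t in E, g t ∂μ = 0 := by
  have huniv : ∫ t, g t ∂μ = 0 := by
    have hmono : Monotone fun n : ℕ => Ioo ((-n : ℚ) : ℝ) ((n : ℚ) : ℝ) := by
      intro m n hmn
      refine Ioo_subset_Ioo ?_ ?_ <;> push_cast <;> simpa using hmn
    have hu : ⋃ n : ℕ, Ioo ((-n : ℚ) : ℝ) ((n : ℚ) : ℝ) = univ := by
      refine eq_univ_of_forall fun x => mem_iUnion.2 ?_
      obtain ⟨n, hn⟩ := exists_nat_gt |x|
      refine ⟨n, ?_⟩
      push_cast
      exact abs_lt.1 hn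
    have := tendsto_setIntegral_of_monotone (μ := μ) (f := g) (fun n => measurableSet_Ioo) hmono
      (by rw [hu]; exact hg.integrableOn)
    rw [hu, setIntegral_univ] at this
    refine tendsto_nhds_unique this ?_
    simp_rw [h]
    exact tendsto_const_nhds
  refine MeasurableSpace.induction_on_inter (C := fun E _ => ∫ t in E, g t ∂μ = 0)
    (BorelSpace.measurable_eq.trans Real.borel_eq_generateFrom_Ioo_rat) Real.isPiSystem_Ioo_rat
    ?_ ?_ ?_ ?_ E hE
  · simp
  · intro t ht
    simp only [mem_iUnion, mem_singleton_iff] at ht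
    obtain ⟨a, b, -, rfl⟩ := ht
    exact h a b
  · intro t ht h0
    rw [setIntegral_compl ht hg, h0, huniv, sub_zero]
  · intro F hd hm h0
    rw [integral_iUnion hm hd hg.integrableOn]
    simp [h0]

lemma uniform_absolute_continuity {μ : Measure ℝ} [IsFiniteMeasure μ] {f : ℝ → X} {u : Set ℝ → X}
    (hf : ∀ x' : X →L[ℝ] ℝ, Integrable (fun t => x' (f t)) μ)
    (hu : ∀ E, MeasurableSet E → ∀ x' : X →L[ℝ] ℝ, x' (u E) = ∫ t in E, x' (f t) ∂μ)
    {ε : ℝ} (hε : 0 < ε) :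
    ∃ η > 0, ∀ E, MeasurableSet E → μ.real E < η → ‖u E‖ ≤ ε := by
  set S : Submodule ℝ X := Submodule.span ℝ (range fun q : ℚ × ℚ => u (Ioo q.1 q.2)) with hS
  have hSsep : TopologicalSpace.IsSeparable (closure (S : Set X)) :=
    ((countable_range _).isSeparable.span (R := ℝ)).closure
  have hmem : ∀ E, MeasurableSet E → u E ∈ closure (S : Set X) := by
    intro E hE
    by_contra hcon
    obtain ⟨x', c, hc, hlt⟩ := geometric_hahn_banach_closed_point
      (S.convex.closure) isClosed_closure hcon
    have hz : ∀ s ∈ S, x' s = 0 := by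
      intro s hs
      by_contra hne
      have := hc _ (subset_closure (S.smul_mem ((|c| + 1) / x' s) hs))
      rw [map_smul, smul_eq_mul, div_mul_cancel₀ _ hne] at this
      linarith [le_abs_self c]
    have h0 := hc 0 (subset_closure S.zero_mem)
    have : x' (u E) = 0 := by
      rw [hu E hE]
      refine eq_zero_of_setIntegral_Ioo_rat (hf x') (fun a b => ?_) hE
      rw [← hu _ measurableSet_Ioo]
      exact hz _ (Submodule.subset_span ⟨(a, b), rfl⟩)
    rw [map_zero] at h0
    linarith
  obtain ⟨D, hDc, hD⟩ := hSsep
  have hcl : ∀ d : X, IsClosed {E : MeasuredSets μ | ‖u E - d‖ ≤ ε / 4} := by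
    intro d
    have : {E : MeasuredSets μ | ‖u E - d‖ ≤ ε / 4} =
        ⋂ x' : X →L[ℝ] ℝ, {E : MeasuredSets μ | |x' (u E) - x' d| ≤ ε / 4 * ‖x'‖} := by
      ext E
      simp only [mem_ofPred_eq, mem_iInter, ← map_sub]
      refine ⟨fun h x' => ?_, fun h => NormedSpace.norm_le_dual_bound ℝ _ (by positivity) h⟩
      exact (x'.le_opNorm _).trans (by rw [mul_comm]; gcongr)
    rw [this]
    refine isClosed_iInter fun x' => isClosed_le ?_ continuous_const
    have h2 : (fun E : MeasuredSets μ => x' (u E)) =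
        fun E : MeasuredSets μ => ∫ t in (E : Set ℝ), x' (f t) ∂μ :=
      funext fun E => hu E E.2 x'
    have h3 := continuous_setIntegral_measuredSets (hf x')
    rw [← h2] at h3
    exact (h3.sub continuous_const).abs
  have hcover : ⋃ d : D, {E : MeasuredSets μ | ‖u E - d‖ ≤ ε / 4} = univ := by
    refine eq_univ_of_forall fun E => mem_iUnion.2 ?_
    obtain ⟨d, hd, hdist⟩ := Metric.mem_closure_iff.1 (hD (hmem E E.2)) (ε / 4) (by positivity)
    exact ⟨⟨d, hd⟩, by simpa [dist_eq_norm] using hdist.le⟩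
  have : Countable D := hDc.to_subtype
  have : Nonempty (MeasuredSets μ) := ⟨⟨∅, MeasurableSet.empty⟩⟩
  obtain ⟨⟨d, hd⟩, E₀, hE₀⟩ := nonempty_interior_of_iUnion_of_closed (fun d : D => hcl d) hcover
  obtain ⟨η, hη, hball⟩ := Metric.isOpen_iff.1 isOpen_interior E₀ hE₀
  refine ⟨η, hη, fun F hF hFη => ?_⟩
  have mE₀ : MeasurableSet (E₀ : Set ℝ) := E₀.2
  have key : ∀ G : MeasuredSets μ, (G : Set ℝ) ∆ E₀ ⊆ F → ‖u G - d‖ ≤ ε / 4 := by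
    intro G hG
    have hG' : G ∈ Metric.ball E₀ η := by
      rw [Metric.mem_ball, MeasuredSets.dist_def]
      exact (measureReal_mono hG).trans_lt hFη
    have := interior_subset (hball hG')
    exact this
  have h1 := key ⟨E₀ ∪ F, E₀.2.union hF⟩ (by
    intro x hx; simp only [mem_symmDiff] at hx
    change (x ∈ (E₀ : Set ℝ) ∪ F ∧ _) ∨ (_ ∧ x ∉ (E₀ : Set ℝ) ∪ F) at hx
    simp only [mem_union] at hx; tauto)
  have h2 := key ⟨E₀ \ F, E₀.2.diff hF⟩ (by
    intro x hx; simp only [mem_symmDiff] at hx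
    change (x ∈ (E₀ : Set ℝ) \ F ∧ _) ∨ (_ ∧ x ∉ (E₀ : Set ℝ) \ F) at hx
    simp only [Set.mem_sdiff] at hx; tauto)
  change ‖u ((E₀ : Set ℝ) ∪ F) - d‖ ≤ _ at h1
  change ‖u ((E₀ : Set ℝ) \ F) - d‖ ≤ _ at h2
  have h12 : ‖u F‖ = ‖(u ((E₀ : Set ℝ) ∪ F) - d) - (u ((E₀ : Set ℝ) \ F) - d)‖ := by
    congr 1
    refine SeparatingDual.eq_iff_forall_dual_eq (R := ℝ) |>.2 fun x' => ?_
    rw [sub_sub_sub_cancel_right, map_sub, hu F hF, hu _ (mE₀.union hF), hu _ (mE₀.diff hF),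
      ← sdiff_union_self, setIntegral_union disjoint_sdiff_left hF (hf x').integrableOn
      (hf x').integrableOn, add_sub_cancel_left]
  rw [h12]
  refine (norm_sub_le _ _).trans ?_
  linarith

/-! ### Riemann sums over an interval -/

/-- `RiemannSum D f a c s`: the vector `s` is the Riemann sum of `f` over some tagged partition of
`[a, c]` all of whose pieces `([p, q], t)` satisfy `D p q t`. -/
inductive RiemannSum (D : ℝ → ℝ → ℝ → Prop) (f : ℝ → X) : ℝ → ℝ → X → Prop
  | nil (a : ℝ) : RiemannSum D f a a 0
  | cons {a b c t : ℝ} {s : X} : a ≤ b → D a b t → RiemannSum D f b c s →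
      RiemannSum D f a c ((b - a) • f t + s)

/-- The piece `([a, b], t)` is `δ`-fine. -/
def FreeFine (δ : ℝ → ℝ) (a b t : ℝ) : Prop :=
  t ∈ Icc (0:ℝ) 1 ∧ Icc a b ⊆ Ioo (t - δ t) (t + δ t)

/-- The piece `([a, b], t)` is `δ`-fine and contains its tag. -/
def PerronFine (δ : ℝ → ℝ) (a b t : ℝ) : Prop :=
  t ∈ Icc a b ∧ FreeFine δ a b t

lemma FreeFine.mono {δ δ' : ℝ → ℝ} {a b t : ℝ} (h : FreeFine δ a b t) (hδ : δ t ≤ δ' t) :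
    FreeFine δ' a b t :=
  ⟨h.1, h.2.trans (Ioo_subset_Ioo (by linarith) (by linarith))⟩

namespace RiemannSum

variable {D D' : ℝ → ℝ → ℝ → Prop} {f : ℝ → X} {a b c t : ℝ} {s s' : X}

lemma single (hab : a ≤ b) (h : D a b t) : RiemannSum D f a b ((b - a) • f t) := by
  simpa using cons (f := f) hab h (nil b)

lemma le (h : RiemannSum D f a b s) : a ≤ b := by
  induction h with
  | nil => exact le_rfl
  | cons hab _ _ ih => exact hab.trans ih

lemma mono (h : RiemannSum D f a b s) (hD : ∀ p q t, D p q t → D' p q t) :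
    RiemannSum D' f a b s := by
  induction h with
  | nil a => exact nil a
  | cons hab hd _ ih => exact cons hab (hD _ _ _ hd) ih

lemma append (h : RiemannSum D f a b s) (h' : RiemannSum D f b c s') :
    RiemannSum D f a c (s + s') := by
  induction h with
  | nil a => simpa using h'
  | cons hab hd _ ih => rw [add_assoc]; exact cons hab hd (ih h')

lemma concat {p : ℕ → ℝ} {s : ℕ → X} (m : ℕ)
    (h : ∀ k < m, RiemannSum D f (p k) (p (k + 1)) (s k)) :
    RiemannSum D f (p 0) (p m) (∑ k ∈ Finset.range m, s k) := by
  induction m with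
  | zero => simpa using nil (D := D) (f := f) (p 0)
  | succ m ih =>
    rw [Finset.sum_range_succ]
    exact (ih fun k hk => h k (hk.trans (Nat.lt_succ_self m))).append (h m (Nat.lt_succ_self m))

/-- A Riemann sum is given by a sequence of division points and a sequence of tags. -/
lemma exists_seq (h : RiemannSum D f a c s) :
    ∃ (n : ℕ) (p tag : ℕ → ℝ), p 0 = a ∧ p n = c ∧
      (∀ k < n, p k ≤ p (k + 1) ∧ D (p k) (p (k + 1)) (tag k)) ∧
      s = ∑ k ∈ Finset.range n, (p (k + 1) - p k) • f (tag k) := by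
  induction h with
  | nil a => exact ⟨0, fun _ => a, fun _ => a, rfl, rfl, by simp, by simp⟩
  | @cons a b c t s hab hd _ ih =>
    obtain ⟨n, p, tag, h0, hn, hk, hs⟩ := ih
    refine ⟨n + 1, fun k => Nat.casesOn k a p, fun k => Nat.casesOn k t tag, rfl, hn, ?_, ?_⟩
    · rintro (_ | k) hkn
      · simpa [h0] using ⟨hab, hd⟩
      · exact hk k (Nat.lt_of_succ_lt_succ hkn)
    · rw [Finset.sum_range_succ', add_comm, hs]
      simp [h0]

lemma exists_TP (h : RiemannSum D f 0 1 s) (hD : ∀ p q t, D p q t → t ∈ Icc (0:ℝ) 1) :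
    ∃ (n : ℕ) (P : TP n), (∀ i, D (P.pt i.castSucc) (P.pt i.succ) (P.tag i)) ∧ fSum P f = s := by
  obtain ⟨n, p, tag, h0, hn, hk, hs⟩ := h.exists_seq
  refine ⟨n, ⟨fun i => p i, fun i => tag i, ?_, h0, by simpa using hn,
    fun i => hD _ _ _ (hk i i.2).2⟩, fun i => (hk i i.2).2, ?_⟩
  · refine Fin.monotone_iff_le_succ.2 fun i => ?_
    simpa using (hk i i.2).1
  · rw [hs, Finset.sum_range]
    rfl

lemma exists_isFine {δ : ℝ → ℝ} (h : RiemannSum (FreeFine δ) f 0 1 s) :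
    ∃ (n : ℕ) (P : TP n), P.IsFine δ ∧ fSum P f = s := by
  obtain ⟨n, P, hP, hs⟩ := h.exists_TP fun _ _ _ h => h.1
  exact ⟨n, P, fun i => (hP i).2, hs⟩

lemma exists_isPerron {δ : ℝ → ℝ} (h : RiemannSum (PerronFine δ) f 0 1 s) :
    ∃ (n : ℕ) (P : TP n), P.IsPerron ∧ P.IsFine δ ∧ fSum P f = s := by
  obtain ⟨n, P, hP, hs⟩ := h.exists_TP fun _ _ _ h => h.2.1
  exact ⟨n, P, fun i => (hP i).1, fun i => (hP i).2.2, hs⟩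

/-- Cousin's lemma. -/
lemma exists_of_local (hab : a ≤ b)
    (h : ∀ t ∈ Icc a b, ∃ r > 0, ∀ p q, a ≤ p → p ≤ t → t ≤ q → q ≤ b → t - r < p → q < t + r →
      D p q t) : ∃ s, RiemannSum D f a b s := by
  set S : Set ℝ := {x | x ∈ Icc a b ∧ ∃ s, RiemannSum D f a x s} with hS
  have ha : a ∈ S := ⟨left_mem_Icc.2 hab, 0, nil a⟩
  have hbd : BddAbove S := ⟨b, fun x hx => hx.1.2⟩
  set c := sSup S with hc
  have hac : a ≤ c := le_csSup hbd ha
  have hcb : c ≤ b := csSup_le ⟨a, ha⟩ fun x hx => hx.1.2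
  obtain ⟨r, hr, hD⟩ := h c ⟨hac, hcb⟩
  obtain ⟨y, ⟨hy, s, hs⟩, hyc⟩ := exists_lt_of_lt_csSup ⟨a, ha⟩ (sub_lt_self c hr)
  have hyc' : y ≤ c := le_csSup hbd ⟨hy, s, hs⟩
  have key : ∀ q, c ≤ q → q ≤ b → q < c + r → q ∈ S := fun q h1 h2 h3 =>
    ⟨⟨hac.trans h1, h2⟩, _, hs.append (single (hyc'.trans h1) (hD y q hy.1 hyc' h1 h2 hyc h3))⟩
  rcases hcb.eq_or_lt with h1 | h1
  · exact (key b h1.le le_rfl (by linarith)).2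
  · exfalso
    have h2 : min b (c + r / 2) ∈ S := key _ (le_min hcb (by linarith)) (min_le_left _ _)
      ((min_le_right _ _).trans_lt (by linarith))
    exact absurd (le_csSup hbd h2) (not_le.2 (lt_min h1 (by linarith)))

lemma exists_perronFine {δ : ℝ → ℝ} (hδ : IsGauge δ) (ha : 0 ≤ a) (hab : a ≤ b) (hb : b ≤ 1) :
    ∃ s, RiemannSum (PerronFine δ) f a b s := by
  refine exists_of_local hab fun t ht => ?_
  have ht' : t ∈ Icc (0:ℝ) 1 := ⟨ha.trans ht.1, ht.2.trans hb⟩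
  exact ⟨δ t, hδ t ht', fun p q _ hpt htq _ h1 h2 =>
    ⟨⟨hpt, htq⟩, ht', fun x hx => ⟨h1.trans_le hx.1, hx.2.trans_lt h2⟩⟩⟩

/-- If every piece contributes at most the increment of an integral, so does the whole sum. -/
lemma apply_le_integral (h : RiemannSum D f a c s) (x' : X →L[ℝ] ℝ) {u : ℝ → ℝ} (hu : Integrable u)
    (hD : ∀ p q t, p ≤ q → D p q t → (q - p) * x' (f t) ≤ ∫ x in p..q, u x) :
    x' s ≤ ∫ x in a..c, u x := by
  induction h with
  | nil a => simp
  | @cons a b c t s hab hd _ ih =>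
    rw [← intervalIntegral.integral_add_adjacent_intervals (b := b)
      hu.intervalIntegrable hu.intervalIntegrable]
    simpa using add_le_add (hD _ _ _ hab hd) ih

end RiemannSum

/-- An integrable function is dominated, on small intervals near each point, by an integrable
function with almost the same integral. -/
lemma exists_gauge_le_integral {k : ℝ → ℝ} (hk : Integrable k) {ε : ℝ} (hε : 0 < ε) :
    ∃ u : ℝ → ℝ, Integrable u ∧ k ≤ᵐ[volume] u ∧ ∫ x, u x ≤ (∫ x, k x) + ε ∧
      ∃ δ : ℝ → ℝ, (∀ t, 0 < δ t) ∧ ∀ t a b, a ≤ b → Icc a b ⊆ Ioo (t - δ t) (t + δ t) →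
        (b - a) * k t ≤ ∫ x in a..b, u x := by
  obtain ⟨g, hfg, hg, hgi, hgt, hge⟩ := exists_lt_lowerSemicontinuous_integral_lt k hk hε
  refine ⟨fun x => (g x).toReal, hgi, ?_, hge.le, ?_⟩
  · filter_upwards [hgt] with x hx
    have := EReal.toReal_le_toReal (hfg x).le (EReal.coe_ne_bot _) hx.ne
    simpa using this
  have h1 : ∀ t, ∃ r > 0, ∀ x ∈ Ioo (t - r) (t + r), (k t : EReal) < g x := by
    intro t
    obtain ⟨r, hr, h⟩ := Metric.eventually_nhds_iff.1 (hg t _ (hfg t))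
    refine ⟨r, hr, fun x hx => h ?_⟩
    rw [Real.dist_eq, abs_lt]
    constructor <;> linarith [hx.1, hx.2]
  choose δ hδ h using h1
  refine ⟨δ, hδ, fun t a b hab hsub => ?_⟩
  have h2 : ∫ x in a..b, k t ≤ ∫ x in a..b, (g x).toReal := by
    refine intervalIntegral.integral_mono_ae_restrict hab (by simp) hgi.intervalIntegrable ?_
    filter_upwards [ae_restrict_of_ae hgt, ae_restrict_mem measurableSet_Icc] with x hx hxm
    have := EReal.toReal_le_toReal (h t x (hsub hxm)).le (EReal.coe_ne_bot _) hx.ne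
    simpa using this
  simpa using h2

lemma RiemannSum.map {Y : Type*} [NormedAddCommGroup Y] [NormedSpace ℝ Y]
    {D : ℝ → ℝ → ℝ → Prop} {f : ℝ → X} {a c : ℝ} {s : X} (h : RiemannSum D f a c s)
    (L : X →L[ℝ] Y) {g : ℝ → Y} (hg : ∀ p q t, D p q t → g t = L (f t)) :
    RiemannSum D g a c (L s) := by
  induction h with
  | nil a => simpa using RiemannSum.nil (D := D) (f := g) a
  | cons hab hd _ ih =>
    rw [map_add, map_smul, ← hg _ _ _ hd]
    exact RiemannSum.cons hab hd ih

lemma exists_gauge_riemannSum_le {k : ℝ → ℝ} (hk : Integrable k) {ε : ℝ} (hε : 0 < ε) :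
    ∃ δ : ℝ → ℝ, (∀ t, 0 < δ t) ∧ ∀ a c s, RiemannSum (FreeFine δ) k a c s →
      s ≤ (∫ x in a..c, k x) + ε := by
  obtain ⟨u, hu, hku, hint, δ, hδ, h⟩ := exists_gauge_le_integral hk hε
  refine ⟨δ, hδ, fun a c s hs => ?_⟩
  have h1 := hs.apply_le_integral (ContinuousLinearMap.id ℝ ℝ) hu
    fun p q t hpq hD => h t p q hpq hD.2
  have h2 : ∫ x in a..c, (u x - k x) ≤ ∫ x, (u x - k x) := by
    rw [intervalIntegral.integral_of_le hs.le]
    refine setIntegral_le_integral (hu.sub hk) ?_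
    filter_upwards [hku] with x hx
    simpa using hx
  rw [intervalIntegral.integral_sub hu.intervalIntegrable hk.intervalIntegrable,
    integral_sub hu hk] at h2
  simp only [ContinuousLinearMap.coe_id', id_eq] at h1
  linarith

lemma exists_gauge_abs_apply_sub_integral_le {f : ℝ → X} (x' : X →L[ℝ] ℝ)
    (hf : IntegrableOn (fun t => x' (f t)) (Icc 0 1)) {ε : ℝ} (hε : 0 < ε) :
    ∃ δ : ℝ → ℝ, (∀ t, 0 < δ t) ∧ ∀ a c s, 0 ≤ a → c ≤ 1 → RiemannSum (FreeFine δ) f a c s →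
      |x' s - ∫ t in a..c, x' (f t)| ≤ ε := by
  set k : ℝ → ℝ := (Icc (0:ℝ) 1).indicator fun t => x' (f t) with hk
  have hki : Integrable k := hf.integrable_indicator measurableSet_Icc
  obtain ⟨δ₁, hδ₁, h₁⟩ := exists_gauge_riemannSum_le hki hε
  obtain ⟨δ₂, hδ₂, h₂⟩ := exists_gauge_riemannSum_le hki.neg hε
  refine ⟨fun t => min (δ₁ t) (δ₂ t), fun t => lt_min (hδ₁ t) (hδ₂ t), fun a c s ha hc hs => ?_⟩
  have hkt : ∀ t ∈ Icc (0:ℝ) 1, k t = x' (f t) := fun t ht => indicator_of_mem ht _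
  have e1 : ∫ t in a..c, k t = ∫ t in a..c, x' (f t) := by
    refine intervalIntegral.integral_congr fun t ht => hkt t ?_
    rw [uIcc_of_le hs.le] at ht
    exact ⟨ha.trans ht.1, ht.2.trans hc⟩
  have g1 := h₁ a c (x' s) ((hs.map x' fun p q t hD => hkt t hD.1).mono fun p q t hD =>
    hD.mono (min_le_left _ _))
  have g2 := h₂ a c ((-x') s) ((hs.map (-x') (g := -k) fun p q t hD => by
    simp [hkt t hD.1]).mono fun p q t hD =>
    hD.mono (min_le_right _ _))
  simp only [Pi.neg_apply, intervalIntegral.integral_neg, neg_apply] at g2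
  rw [e1] at g1 g2
  rw [abs_le]
  constructor <;> linarith

lemma fSum_riemannSum {n : ℕ} (P : TP n) {δ : ℝ → ℝ} (hP : P.IsFine δ) (f : ℝ → X) :
    RiemannSum (FreeFine δ) f 0 1 (fSum P f) := by
  have h := RiemannSum.concat (D := FreeFine δ) (f := f)
    (p := fun k => if h : k < n + 1 then P.pt ⟨k, h⟩ else 1)
    (s := fun k => if h : k < n then P.len ⟨k, h⟩ • f (P.tag ⟨k, h⟩) else 0) n fun k hk => by
      have h1 : k < n + 1 := by omega
      simp only [hk, h1, dif_pos, Nat.add_lt_add_iff_right]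
      exact RiemannSum.single (P.mono (Fin.castSucc_lt_succ (i := ⟨k, hk⟩)).le)
        ⟨P.tagMem _, hP ⟨k, hk⟩⟩
  have h0 : P.pt ⟨0, by omega⟩ = 0 := P.first
  have h1 : P.pt ⟨n, by omega⟩ = 1 := P.last
  simp only [Nat.zero_lt_succ, Nat.lt_succ_self, dif_pos, h0, h1] at h
  rw [Finset.sum_range] at h
  simpa [fSum] using h

/-- The scalar images of a Pettis integrable function under the dual unit ball are uniformly
integrable. -/
lemma FPettisIntegrable.uniformIntegrable [CompleteSpace X] {f : ℝ → X}
    (hf : FPettisIntegrable f) {ε : ℝ} (hε : 0 < ε) :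
    ∃ η > 0, ∀ E, MeasurableSet E → (volume.restrict (Icc (0:ℝ) 1)).real E < η →
      ∀ x' : X →L[ℝ] ℝ, ‖x'‖ ≤ 1 → ∫ t in E, |x' (f t)| ∂volume.restrict (Icc (0:ℝ) 1) ≤ ε := by
  have hex : ∀ E : Set ℝ, ∃ w : X, MeasurableSet E → ∀ x' : X →L[ℝ] ℝ,
      x' w = ∫ t in E, x' (f t) ∂volume.restrict (Icc (0:ℝ) 1) := by
    intro E
    by_cases hE : MeasurableSet E
    · obtain ⟨w, hw⟩ := hf.2 (E ∩ Icc 0 1) inter_subset_right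
        (hE.inter measurableSet_Icc).nullMeasurableSet
      exact ⟨w, fun _ x' => by rw [hw, Measure.restrict_restrict hE]⟩
    · exact ⟨0, fun h => absurd h hE⟩
  choose u hu using hex
  obtain ⟨η, hη, h⟩ := uniform_absolute_continuity (μ := volume.restrict (Icc (0:ℝ) 1))
    hf.1 hu (half_pos hε)
  refine ⟨η, hη, fun E hE hEη x' hx' => ?_⟩
  have hint : Integrable (fun t => x' (f t)) (volume.restrict (Icc (0:ℝ) 1)) := hf.1 x'
  set g := hint.1.mk with hg
  have hgm : StronglyMeasurable g := hint.1.stronglyMeasurable_mk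
  have hgf : (fun t => x' (f t)) =ᵐ[volume.restrict (Icc (0:ℝ) 1)] g := hint.1.ae_eq_mk
  have hgi : Integrable g (volume.restrict (Icc (0:ℝ) 1)) := hint.congr hgf
  have hS : MeasurableSet {t | 0 ≤ g t} := hgm.measurable measurableSet_Ici
  have hbound : ∀ A, MeasurableSet A → A ⊆ E →
      |∫ t in A, g t ∂volume.restrict (Icc (0:ℝ) 1)| ≤ ε / 2 := by
    intro A hA hAE
    rw [← integral_congr_ae (ae_restrict_of_ae hgf), ← hu A hA, ← Real.norm_eq_abs]
    refine (x'.le_of_opNorm_le hx' _).trans ?_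
    rw [one_mul]
    exact h A hA ((measureReal_mono hAE).trans_lt hEη)
  have e1 : ∫ t in E, |x' (f t)| ∂volume.restrict (Icc (0:ℝ) 1) =
      ∫ t in E, |g t| ∂volume.restrict (Icc (0:ℝ) 1) := by
    refine integral_congr_ae (ae_restrict_of_ae ?_)
    filter_upwards [hgf] with t ht
    rw [ht]
  have e2 : ∫ t in E ∩ {t | 0 ≤ g t}, |g t| ∂volume.restrict (Icc (0:ℝ) 1) =
      ∫ t in E ∩ {t | 0 ≤ g t}, g t ∂volume.restrict (Icc (0:ℝ) 1) :=
    setIntegral_congr_fun (hE.inter hS) fun t ht => abs_of_nonneg ht.2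
  have e3 : ∫ t in E \ {t | 0 ≤ g t}, |g t| ∂volume.restrict (Icc (0:ℝ) 1) =
      - ∫ t in E \ {t | 0 ≤ g t}, g t ∂volume.restrict (Icc (0:ℝ) 1) := by
    rw [← integral_neg]
    exact setIntegral_congr_fun (hE.diff hS) fun t ht => abs_of_neg (not_le.1 ht.2)
  rw [e1, ← integral_inter_add_sdiff hS hgi.abs.integrableOn, e2, e3]
  have h1 := hbound _ (hE.inter hS) inter_subset_left
  have h2 := hbound _ (hE.diff hS) sdiff_subset
  rw [abs_le] at h1 h2
  linarith [h1.2, h2.1]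

lemma FPettisIntegrable.exists_integral_le [CompleteSpace X] {f : ℝ → X}
    (hf : FPettisIntegrable f) :
    ∃ M : ℝ, 0 < M ∧ ∀ x' : X →L[ℝ] ℝ, ‖x'‖ ≤ 1 →
      ∫ t, |x' (f t)| ∂volume.restrict (Icc (0:ℝ) 1) ≤ M := by
  obtain ⟨η, hη, h⟩ := hf.uniformIntegrable one_pos
  obtain ⟨N, hN⟩ := exists_nat_one_div_lt hη
  refine ⟨N + 1, by positivity, fun x' hx' => ?_⟩
  have hint : Integrable (fun t => |x' (f t)|) (volume.restrict (Icc (0:ℝ) 1)) := (hf.1 x').abs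
  have hN0 : (0:ℝ) < N + 1 := by positivity
  have e1 : ∫ t, |x' (f t)| ∂volume.restrict (Icc (0:ℝ) 1) =
      ∑ k ∈ Finset.range (N + 1), ∫ t in ((k:ℕ):ℝ) / (N + 1)..((k + 1 : ℕ) : ℝ) / (N + 1),
        |x' (f t)| ∂volume.restrict (Icc (0:ℝ) 1) := by
    rw [intervalIntegral.sum_integral_adjacent_intervals
      (a := fun k : ℕ => (k:ℝ) / (N + 1)) fun k _ => hint.intervalIntegrable]
    have h1 : ((N + 1 : ℕ) : ℝ) / (N + 1) = 1 := by push_cast; exact div_self hN0.ne'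
    rw [h1, Nat.cast_zero, zero_div, intervalIntegral.integral_of_le zero_le_one,
      Measure.restrict_restrict measurableSet_Ioc,
      inter_eq_self_of_subset_left Ioc_subset_Icc_self, integral_Icc_eq_integral_Ioc]
  rw [e1]
  have h2 : ∀ k ∈ Finset.range (N + 1),
      ∫ t in ((k:ℕ):ℝ) / (N + 1)..((k + 1 : ℕ) : ℝ) / (N + 1),
        |x' (f t)| ∂volume.restrict (Icc (0:ℝ) 1) ≤ 1 := by
    intro k _
    have hle : (k:ℝ) / (N + 1) ≤ ((k + 1 : ℕ) : ℝ) / (N + 1) := by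
      gcongr; simp
    rw [intervalIntegral.integral_of_le hle]
    refine h _ measurableSet_Ioc ?_ x' hx'
    refine lt_of_le_of_lt ?_ hN
    rw [measureReal_restrict_apply measurableSet_Ioc]
    refine (measureReal_mono inter_subset_left (by simp)).trans ?_
    rw [Real.volume_real_Ioc_of_le hle]
    push_cast
    exact le_of_eq (by ring)
  simpa using Finset.sum_le_sum h2

/-- Uniform integrability, tested against weights with small integral. -/
lemma FPettisIntegrable.weighted [CompleteSpace X] {f : ℝ → X}
    (hf : FPettisIntegrable f) {ε : ℝ} (hε : 0 < ε) :
    ∃ η > 0, ∀ ψ : ℝ → ℝ, Measurable ψ → (∀ t, 0 ≤ ψ t) → (∀ t, ψ t ≤ 1) →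
      ∫ t, ψ t ∂volume.restrict (Icc (0:ℝ) 1) ≤ η →
      ∀ x' : X →L[ℝ] ℝ, ‖x'‖ ≤ 1 →
        |∫ t, ψ t * x' (f t) ∂volume.restrict (Icc (0:ℝ) 1)| ≤ ε := by
  obtain ⟨M, hM, hb⟩ := hf.exists_integral_le
  obtain ⟨η, hη, h⟩ := hf.uniformIntegrable (half_pos hε)
  set τ := ε / 2 / M with hτ
  have hτ0 : 0 < τ := by positivity
  refine ⟨τ * (η / 2), by positivity, fun ψ hψ h0 h1 hψη x' hx' => ?_⟩
  set μ := volume.restrict (Icc (0:ℝ) 1) with hμ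
  have hint : Integrable (fun t => |x' (f t)|) μ := (hf.1 x').abs
  have hS : MeasurableSet {t | τ ≤ ψ t} := hψ measurableSet_Ici
  have hψi : Integrable ψ μ := by
    refine Integrable.of_bound hψ.aestronglyMeasurable 1 (Eventually.of_forall fun t => ?_)
    rw [Real.norm_of_nonneg (h0 t)]; exact h1 t
  have hmul : Integrable (fun t => ψ t * |x' (f t)|) μ := by
    refine hint.bdd_mul (c := 1) hψ.aestronglyMeasurable (Eventually.of_forall fun t => ?_)
    rw [Real.norm_of_nonneg (h0 t)]; exact h1 t
  have hsmall : μ.real {t | τ ≤ ψ t} < η := by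
    have := mul_meas_ge_le_integral_of_nonneg (Eventually.of_forall h0) hψi τ
    have h3 := le_of_mul_le_mul_left (this.trans hψη) hτ0
    linarith
  refine abs_integral_le_integral_abs.trans ?_
  simp only [abs_mul, abs_of_nonneg (h0 _)]
  rw [← integral_add_compl hS hmul]
  have a1 : ∫ t in {t | τ ≤ ψ t}, ψ t * |x' (f t)| ∂μ ≤ ε / 2 := by
    refine le_trans ?_ (h _ hS hsmall x' hx')
    refine setIntegral_mono hmul.integrableOn hint.integrableOn fun t => ?_
    exact mul_le_of_le_one_left (abs_nonneg _) (h1 t)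
  have a2 : ∫ t in {t | τ ≤ ψ t}ᶜ, ψ t * |x' (f t)| ∂μ ≤ τ * M := by
    calc ∫ t in {t | τ ≤ ψ t}ᶜ, ψ t * |x' (f t)| ∂μ
        ≤ ∫ t in {t | τ ≤ ψ t}ᶜ, τ * |x' (f t)| ∂μ := by
          refine setIntegral_mono_on hmul.integrableOn (hint.const_mul τ).integrableOn hS.compl
            fun t ht => ?_
          exact mul_le_mul_of_nonneg_right (not_le.1 (show ¬ τ ≤ ψ t from ht)).le (abs_nonneg _)
      _ ≤ ∫ t, τ * |x' (f t)| ∂μ :=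
          setIntegral_le_integral (hint.const_mul τ)
            (Eventually.of_forall fun t => mul_nonneg hτ0.le (abs_nonneg _))
      _ = τ * ∫ t, |x' (f t)| ∂μ := integral_const_mul _ _
      _ ≤ τ * M := mul_le_mul_of_nonneg_left (hb x' hx') hτ0.le
  have a3 : τ * M = ε / 2 := div_mul_cancel₀ _ hM.ne'
  linarith

/-- The `ℋ`-integral is computed by the scalar Lebesgue integrals. -/
lemma apply_eq_integral_of_perron {f : ℝ → X} {w : X} (x' : X →L[ℝ] ℝ)
    (hf : IntegrableOn (fun t => x' (f t)) (Icc 0 1))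
    (hw : ∀ ε > 0, ∃ δ : ℝ → ℝ, IsGauge δ ∧
      ∀ (n : ℕ) (P : TP n), P.IsPerron → P.IsFine δ → ‖w - fSum P f‖ < ε) :
    x' w = ∫ t in (0:ℝ)..1, x' (f t) := by
  refine eq_of_abs_sub_le_all fun ε hε => ?_
  have hc : 0 < ε / 2 / (‖x'‖ + 1) := by positivity
  obtain ⟨δ₁, hδ₁, h₁⟩ := hw _ hc
  obtain ⟨δ₂, hδ₂, h₂⟩ := exists_gauge_abs_apply_sub_integral_le x' hf (half_pos hε)
  have hδ : IsGauge fun t => min (δ₁ t) (δ₂ t) := fun t ht => lt_min (hδ₁ t ht) (hδ₂ t)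
  obtain ⟨s, hs⟩ := RiemannSum.exists_perronFine (f := f) hδ le_rfl zero_le_one le_rfl
  obtain ⟨n, P, hPp, hPf, rfl⟩ := (hs.mono (D' := PerronFine δ₁) fun p q t hD =>
    ⟨hD.1, hD.2.mono (min_le_left _ _)⟩).exists_isPerron
  have g1 := h₁ n P hPp hPf
  have g2 := h₂ 0 1 _ le_rfl le_rfl (hs.mono fun p q t hD =>
    hD.2.mono (min_le_right _ _))
  have g3 : |x' w - x' (fSum P f)| ≤ ε / 2 := by
    rw [← map_sub, ← Real.norm_eq_abs]
    refine (x'.le_opNorm _).trans ?_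
    calc ‖x'‖ * ‖w - fSum P f‖ ≤ (‖x'‖ + 1) * (ε / 2 / (‖x'‖ + 1)) := by
          gcongr; linarith
      _ = ε / 2 := by field_simp
  calc _ = |(x' w - x' (fSum P f)) + (x' (fSum P f) - ∫ t in (0:ℝ)..1, x' (f t))| := by
        congr 1; ring
    _ ≤ _ := (abs_add_le _ _).trans (by linarith)

/-! ### From `ℋ`-integrability to Riemann sums with free tags -/

/-- Saks–Henstock estimate on the uniform mesh `j / N`, for tags where the gauge exceeds `1 / N`. -/
lemma abs_sum_mesh_le {f : ℝ → X} {w : X} {δ : ℝ → ℝ} {ε : ℝ} (hδ : IsGauge δ)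
    (h : ∀ (n : ℕ) (P : TP n), P.IsPerron → P.IsFine δ → ‖w - fSum P f‖ < ε)
    {x' : X →L[ℝ] ℝ} (hx' : ‖x'‖ ≤ 1) (hf : IntegrableOn (fun t => x' (f t)) (Icc 0 1))
    (hw : x' w = ∫ t in (0:ℝ)..1, x' (f t)) {N : ℕ} (hN : 0 < N) {S : Finset ℕ} {τ : ℕ → ℝ}
    (hS : ∀ j ∈ S, j < N ∧ τ j ∈ Icc ((j:ℝ) / N) ((j + 1 : ℕ) / N) ∧ 1 / (N:ℝ) < δ (τ j)) :
    |∑ j ∈ S, (1 / N * x' (f (τ j)) - ∫ t in ((j:ℝ) / N)..((j + 1 : ℕ) / N), x' (f t))| ≤ ε := by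
  have hN0 : (0:ℝ) < N := by exact_mod_cast hN
  refine le_of_forall_pos_le_add fun ρ hρ => ?_
  obtain ⟨δ₂, hδ₂, h₂⟩ := exists_gauge_abs_apply_sub_integral_le x' hf (div_pos hρ hN0)
  have hmin : IsGauge fun t => min (δ t) (δ₂ t) := fun t ht => lt_min (hδ t ht) (hδ₂ t)
  have hle : ∀ j : ℕ, (j:ℝ) / N ≤ ((j + 1 : ℕ) : ℝ) / N := fun j => by gcongr; simp
  have hlen : ∀ j : ℕ, ((j + 1 : ℕ) : ℝ) / N - (j:ℝ) / N = 1 / N := fun j => by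
    push_cast; ring
  have h0 : ∀ j : ℕ, 0 ≤ (j:ℝ) / N := fun j => by positivity
  have h1 : ∀ j : ℕ, j < N → ((j + 1 : ℕ) : ℝ) / N ≤ 1 := fun j hj => by
    rw [div_le_one hN0]; exact_mod_cast hj
  have hex : ∀ j : ℕ, ∃ s : X, (j ∈ S → s = (1 / N : ℝ) • f (τ j)) ∧ (j < N →
      RiemannSum (PerronFine δ) f ((j:ℝ) / N) ((j + 1 : ℕ) / N) s ∧
      (j ∉ S → |x' s - ∫ t in ((j:ℝ) / N)..((j + 1 : ℕ) / N), x' (f t)| ≤ ρ / N)) := by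
    intro j
    by_cases hj : j ∈ S
    · obtain ⟨hjN, hτ, hjδ⟩ := hS j hj
      refine ⟨_, fun _ => rfl, fun _ => ⟨?_, fun h => absurd hj h⟩⟩
      rw [← hlen j]
      refine RiemannSum.single (hle j) ⟨hτ, ⟨(h0 j).trans hτ.1, hτ.2.trans (h1 j hjN)⟩, ?_⟩
      intro x hx
      have := hlen j
      constructor <;> linarith [hx.1, hx.2, hτ.1, hτ.2]
    · by_cases hjN : j < N
      · obtain ⟨s, hs⟩ := RiemannSum.exists_perronFine (f := f) hmin (h0 j) (hle j) (h1 j hjN)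
        refine ⟨s, fun h => absurd h hj, fun _ => ⟨hs.mono fun p q t hD =>
          ⟨hD.1, hD.2.mono (min_le_left _ _)⟩, fun _ => ?_⟩⟩
        exact h₂ _ _ _ (h0 j) (h1 j hjN) (hs.mono fun p q t hD => hD.2.mono (min_le_right _ _))
      · exact ⟨0, fun h => absurd h hj, fun h => absurd h hjN⟩
  choose s hsS hs using hex
  have hsum := RiemannSum.concat (p := fun j : ℕ => (j:ℝ) / N) N fun j hj => (hs j hj).1
  simp only [Nat.cast_zero, zero_div, div_self hN0.ne'] at hsum
  obtain ⟨n, P, hP, hPf, hPs⟩ := hsum.exists_isPerron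
  have g1 : |x' w - ∑ j ∈ Finset.range N, x' (s j)| ≤ ε := by
    rw [← map_sum, ← hPs, ← map_sub, ← Real.norm_eq_abs]
    refine (x'.le_of_opNorm_le hx' _).trans ?_
    rw [one_mul]
    exact (h n P hP hPf).le
  have hint : ∀ j < N, IntervalIntegrable (fun t => x' (f t)) volume
      ((j:ℝ) / N) ((j + 1 : ℕ) / N) := fun j hj => by
    rw [intervalIntegrable_iff_integrableOn_Icc_of_le (hle j)]
    exact hf.mono_set (Icc_subset_Icc (h0 j) (h1 j hj))
  have g2 : x' w = ∑ j ∈ Finset.range N, ∫ t in ((j:ℝ) / N)..((j + 1 : ℕ) / N), x' (f t) := by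
    rw [hw, intervalIntegral.sum_integral_adjacent_intervals (a := fun j : ℕ => (j:ℝ) / N) hint,
      Nat.cast_zero, zero_div, div_self hN0.ne']
  have hSN : S ⊆ Finset.range N := fun j hj => Finset.mem_range.2 (hS j hj).1
  rw [g2, abs_sub_comm, ← Finset.sum_sub_distrib, ← Finset.sum_sdiff hSN] at g1
  have g3 : ∑ j ∈ S, (x' (s j) - ∫ t in ((j:ℝ) / N)..((j + 1 : ℕ) / N), x' (f t)) =
      ∑ j ∈ S, (1 / N * x' (f (τ j)) - ∫ t in ((j:ℝ) / N)..((j + 1 : ℕ) / N), x' (f t)) := by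
    refine Finset.sum_congr rfl fun j hj => ?_
    rw [hsS j hj, map_smul, smul_eq_mul]
  have g4 : |∑ j ∈ Finset.range N \ S,
      (x' (s j) - ∫ t in ((j:ℝ) / N)..((j + 1 : ℕ) / N), x' (f t))| ≤ ρ := by
    refine (Finset.abs_sum_le_sum_abs _ _).trans ?_
    calc _ ≤ ∑ j ∈ Finset.range N \ S, ρ / N := Finset.sum_le_sum fun j hj => by
            rw [Finset.mem_sdiff, Finset.mem_range] at hj
            exact (hs j hj.1).2 hj.2
      _ ≤ ∑ j ∈ Finset.range N, ρ / N :=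
          Finset.sum_le_sum_of_subset_of_nonneg Finset.sdiff_subset fun _ _ _ => by positivity
      _ = ρ := by rw [Finset.sum_const, Finset.card_range, nsmul_eq_mul]; field_simp
  rw [g3] at g1
  rw [abs_le] at g1 g4 ⊢
  constructor <;> linarith [g1.1, g1.2, g4.1, g4.2]

lemma sum_mul_le_of_selection {ι κ : Type*} [DecidableEq κ] {s : Finset ι} {l : ι → κ}
    {α v : ι → ℝ} {ε : ℝ} (hα : ∀ i ∈ s, 0 ≤ α i)
    (hfib : ∀ j, ∑ i ∈ s with l i = j, α i ≤ 1)
    (h : ∀ T ⊆ s, Set.InjOn l T → ∑ i ∈ T, v i ≤ ε) : ∑ i ∈ s, α i * v i ≤ ε := by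
  classical
  rcases s.eq_empty_or_nonempty with rfl | ⟨i₀, hi₀⟩
  · simpa using h ∅ (Finset.Subset.refl _) (by simp)
  have hex : ∀ j, ∃ i, j ∈ s.image l → i ∈ s ∧ l i = j ∧ ∀ k ∈ s, l k = j → v k ≤ v i := by
    intro j
    by_cases hj : j ∈ s.image l
    · obtain ⟨i, hi, rfl⟩ := Finset.mem_image.1 hj
      obtain ⟨k, hk, hmax⟩ := Finset.exists_max_image (s.filter fun k => l k = l i) v
        ⟨i, Finset.mem_filter.2 ⟨hi, rfl⟩⟩
      rw [Finset.mem_filter] at hk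
      exact ⟨k, fun _ => ⟨hk.1, hk.2, fun m hm hml => hmax m (Finset.mem_filter.2 ⟨hm, hml⟩)⟩⟩
    · exact ⟨i₀, fun h => absurd h hj⟩
  choose r hr using hex
  set J := (s.image l).filter fun j => 0 < v (r j) with hJ
  have hJs : ∀ j ∈ J, j ∈ s.image l := fun j hj => (Finset.mem_filter.1 hj).1
  have hrinj : Set.InjOn r J := fun j hj j' hj' e => by
    rw [← (hr j (hJs j hj)).2.1, e, (hr j' (hJs j' hj')).2.1]
  have hT := h (J.image r) (fun i hi => by
    obtain ⟨j, hj, rfl⟩ := Finset.mem_image.1 hi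
    exact (hr j (hJs j hj)).1) (by
    intro i hi i' hi' e
    obtain ⟨j, hj, rfl⟩ := Finset.mem_image.1 hi
    obtain ⟨j', hj', rfl⟩ := Finset.mem_image.1 hi'
    rw [(hr j (hJs j hj)).2.1, (hr j' (hJs j' hj')).2.1] at e
    rw [e])
  rw [Finset.sum_image hrinj] at hT
  refine le_trans ?_ hT
  rw [← Finset.sum_fiberwise_of_maps_to (t := s.image l)
    (fun i hi => Finset.mem_image_of_mem l hi), Finset.sum_filter]
  refine Finset.sum_le_sum fun j hj => ?_
  obtain ⟨-, -, hmax⟩ := hr j hj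
  have hnn : 0 ≤ ∑ i ∈ s with l i = j, α i :=
    Finset.sum_nonneg fun i hi => hα i (Finset.mem_filter.1 hi).1
  have h1 : ∑ i ∈ s with l i = j, α i * v i ≤ (∑ i ∈ s with l i = j, α i) * v (r j) := by
    rw [Finset.sum_mul]
    refine Finset.sum_le_sum fun i hi => ?_
    rw [Finset.mem_filter] at hi
    exact mul_le_mul_of_nonneg_left (hmax i hi.1 hi.2) (hα i hi.1)
  refine h1.trans ?_
  split_ifs with hpos
  · exact mul_le_of_le_one_left hpos.le (hfib j)
  · exact mul_nonpos_of_nonneg_of_nonpos hnn (not_lt.1 hpos)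

lemma sum_length_le {ι : Type*} {s : Finset ι} {a b : ι → ℝ} {c d : ℝ} (hcd : c ≤ d)
    (hab : ∀ i ∈ s, a i ≤ b i)
    (hdisj : (s : Set ι).PairwiseDisjoint fun i => Ioc (a i) (b i))
    (hsub : ∀ i ∈ s, Ioc (a i) (b i) ⊆ Ioc c d) : ∑ i ∈ s, (b i - a i) ≤ d - c := by
  have h1 : volume.real (⋃ i ∈ s, Ioc (a i) (b i)) ≤ volume.real (Ioc c d) :=
    measureReal_mono (iUnion₂_subset hsub) (by simp)
  rw [measureReal_biUnion_finset hdisj (fun _ _ => measurableSet_Ioc) (by simp),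
    Real.volume_real_Ioc_of_le hcd] at h1
  refine le_trans (le_of_eq (Finset.sum_congr rfl fun i hi => ?_)) h1
  rw [Real.volume_real_Ioc_of_le (hab i hi)]

lemma exists_isCompact_gauge_gt {δ : ℝ → ℝ} (hδ : IsGauge δ) (hm : AEMeasurable δ volume)
    {R : Set ℝ} (hR : MeasurableSet R) (hR1 : R ⊆ Icc 0 1) {κ : ℝ≥0∞} (hκ : 0 < κ) :
    ∃ C ⊆ R, IsCompact C ∧ volume (R \ C) < κ ∧ ∃ c > 0, ∀ t ∈ C, c < δ t := by
  obtain ⟨M, hMsub, hMm, hM0⟩ := exists_measurable_superset_of_null (ae_iff.1 hm.ae_eq_mk)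
  have hδM : ∀ t ∉ M, δ t = hm.mk δ t := fun t ht => by
    by_contra hne
    exact ht (hMsub hne)
  set A : ℕ → Set ℝ := fun n => (R ∩ {t | 1 / ((n:ℝ) + 1) < hm.mk δ t}) \ M with hA
  have hAm : ∀ n, MeasurableSet (A n) := fun n =>
    (hR.inter (hm.measurable_mk measurableSet_Ioi)).diff hMm
  have hRfin : volume R ≠ ∞ := ((measure_mono hR1).trans_lt (by simp)).ne
  have htend : Tendsto (fun n => volume (R \ A n)) atTop (𝓝 0) := by
    have hanti : Antitone fun n => R \ A n := by
      intro n m hnm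
      refine sdiff_subset_sdiff_right (sdiff_subset_sdiff_left (inter_subset_inter_right _ ?_))
      intro t (ht : 1 / ((n:ℝ) + 1) < hm.mk δ t)
      exact lt_of_le_of_lt (Nat.one_div_le_one_div hnm) ht
    have h1 := tendsto_measure_iInter_atTop (μ := volume)
      (fun n => (hR.diff (hAm n)).nullMeasurableSet) hanti
      ⟨0, measure_ne_top_of_subset sdiff_subset hRfin⟩
    have h2 : volume (⋂ n, R \ A n) = 0 := by
      refine measure_mono_null (fun t ht => ?_) hM0
      by_contra htM
      have htR : t ∈ R := (mem_iInter.1 ht 0).1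
      obtain ⟨n, hn⟩ := exists_nat_one_div_lt (hδ t (hR1 htR))
      rw [hδM t htM] at hn
      exact (mem_iInter.1 ht n).2 ⟨⟨htR, hn⟩, htM⟩
    rwa [h2] at h1
  obtain ⟨n, hn⟩ := (htend.eventually (gt_mem_nhds (ENNReal.half_pos hκ.ne'))).exists
  obtain ⟨C, hCA, hC, hCκ⟩ := (hAm n).exists_isCompact_sdiff_lt
    (measure_ne_top_of_subset (sdiff_subset.trans inter_subset_left) hRfin)
    (ENNReal.half_pos hκ.ne').ne'
  refine ⟨C, hCA.trans (sdiff_subset.trans inter_subset_left), hC, ?_, 1 / ((n:ℝ) + 1),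
    by positivity, fun t ht => ?_⟩
  · refine lt_of_le_of_lt (measure_mono (t := (R \ A n) ∪ (A n \ C)) fun t ht => ?_)
      ((measure_union_le _ _).trans_lt ((ENNReal.add_lt_add hn hCκ).trans_eq
        (ENNReal.add_halves κ)))
    by_cases h : t ∈ A n
    · exact Or.inr ⟨h, ht.2⟩
    · exact Or.inl ⟨ht.1, h⟩
  · rw [hδM t (hCA ht).2]
    exact (hCA ht).1.2

/-- The distance from `t` to the mesh `ℤ / N`. -/
noncomputable def meshGauge (N : ℕ) (t : ℝ) : ℝ :=
  min (Int.fract (N * t)) (1 - Int.fract (N * t)) / N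

lemma measurable_meshGauge (N : ℕ) : Measurable (meshGauge N) := by
  unfold meshGauge
  have h : Measurable fun t : ℝ => Int.fract (N * t) :=
    measurable_fract.comp (measurable_const_mul _)
  exact (h.min (measurable_const.sub h)).div_const _

lemma meshGauge_pos {N : ℕ} (hN : 0 < N) {t : ℝ} (ht : Irrational t) : 0 < meshGauge N t := by
  have h1 : Int.fract ((N:ℝ) * t) ≠ 0 := fun h => by
    rw [Int.fract_eq_iff] at h
    obtain ⟨-, -, z, hz⟩ := h
    exact (ht.natCast_mul hN.ne').ne_int z (by simpa using hz)
  have h2 : 0 < Int.fract ((N:ℝ) * t) := lt_of_le_of_ne (Int.fract_nonneg _) h1.symm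
  have h3 := Int.fract_lt_one ((N:ℝ) * t)
  have hN0 : (0:ℝ) < N := by exact_mod_cast hN
  exact div_pos (lt_min h2 (by linarith)) hN0

lemma cell_of_meshGauge {N : ℕ} (hN : 0 < N) {t a b : ℝ} (ht : t ∈ Icc (0:ℝ) 1) (hab : a ≤ b)
    (h : Icc a b ⊆ Ioo (t - meshGauge N t) (t + meshGauge N t)) :
    ⌊N * t⌋₊ < N ∧ t ∈ Icc ((⌊N * t⌋₊ : ℝ) / N) ((⌊N * t⌋₊ + 1 : ℕ) / N) ∧
      Icc a b ⊆ Ioo ((⌊N * t⌋₊ : ℝ) / N) ((⌊N * t⌋₊ + 1 : ℕ) / N) := by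
  have hN0 : (0:ℝ) < N := by exact_mod_cast hN
  have hNt : 0 ≤ N * t := mul_nonneg hN0.le ht.1
  have hfl : (⌊(N:ℝ) * t⌋ : ℝ) = (⌊(N:ℝ) * t⌋₊ : ℝ) := by
    rw [← Int.natCast_floor_eq_floor hNt]; simp
  have hfr : Int.fract ((N:ℝ) * t) = N * t - ⌊(N:ℝ) * t⌋₊ := by
    rw [← hfl]; rfl
  have hd : 0 < meshGauge N t := by
    have := h (left_mem_Icc.2 hab)
    linarith [this.1, this.2]
  have hd1 : meshGauge N t * N ≤ N * t - ⌊(N:ℝ) * t⌋₊ := by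
    rw [meshGauge, div_mul_cancel₀ _ hN0.ne', ← hfr]; exact min_le_left _ _
  have hd2 : meshGauge N t * N ≤ 1 - (N * t - ⌊(N:ℝ) * t⌋₊) := by
    rw [meshGauge, div_mul_cancel₀ _ hN0.ne', ← hfr]; exact min_le_right _ _
  have hdN := mul_pos hd hN0
  refine ⟨?_, ⟨?_, ?_⟩, h.trans (Ioo_subset_Ioo ?_ ?_)⟩
  · by_contra hcon
    have h1 : (N:ℝ) ≤ ⌊(N:ℝ) * t⌋₊ := by exact_mod_cast not_lt.1 hcon
    nlinarith [ht.2]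
  · rw [div_le_iff₀ hN0]; linarith
  · rw [le_div_iff₀ hN0]; push_cast; linarith
  · rw [div_le_iff₀ hN0]; linarith
  · rw [le_div_iff₀ hN0]; push_cast; linarith

lemma exists_mesh_cthickening_lt {C : Set ℝ} (hC : IsCompact C) {c η : ℝ} (hc : 0 < c)
    (hη : 0 < η) : ∃ N : ℕ, 0 < N ∧ 1 / (N:ℝ) < c ∧
      volume.real (cthickening (1 / (N:ℝ)) C \ C) ≤ η := by
  have h1 : Tendsto (fun n : ℕ => volume (cthickening (1 / ((n:ℝ) + 1)) C)) atTop (𝓝 (volume C)) :=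
    (tendsto_measure_cthickening_of_isCompact hC).comp tendsto_one_div_add_atTop_nhds_zero_nat
  have hfin : volume C ≠ ∞ := hC.measure_lt_top.ne
  have h2 := h1.eventually (gt_mem_nhds (ENNReal.lt_add_right hfin
    (ENNReal.ofReal_pos.2 hη).ne'))
  have h3 := tendsto_one_div_add_atTop_nhds_zero_nat.eventually (gt_mem_nhds hc)
  obtain ⟨n, hn2, hn3⟩ := (h2.and h3).exists
  refine ⟨n + 1, n.succ_pos, by simpa using hn3, ?_⟩
  push_cast
  rw [measureReal_def, measure_sdiff (self_subset_cthickening C) hC.measurableSet.nullMeasurableSet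
    hfin]
  refine ENNReal.toReal_le_of_le_ofReal hη.le ?_
  rw [tsub_le_iff_right, add_comm (ENNReal.ofReal η)]
  exact hn2.le

/-- The density spreading the length of each interval of a family uniformly over the cell of the
mesh `ℤ / N` with the given index. -/
noncomputable def cellDensity {ι : Type*} (N : ℕ) (s : Finset ι) (l : ι → ℕ) (a b : ι → ℝ)
    (x : ℝ) : ℝ :=
  ∑ i ∈ s, (Ico ((l i : ℝ) / N) ((l i + 1 : ℕ) / N)).indicator (fun _ => N * (b i - a i)) x

section cellDensity

variable {ι : Type*} {N : ℕ} {s : Finset ι} {l : ι → ℕ} {a b : ι → ℝ}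

lemma measurable_cellDensity : Measurable (cellDensity N s l a b) :=
  Finset.measurable_sum _ fun _ _ => measurable_const.indicator measurableSet_Ico

lemma cellDensity_nonneg (hab : ∀ i ∈ s, a i ≤ b i) (x : ℝ) : 0 ≤ cellDensity N s l a b x :=
  Finset.sum_nonneg fun i hi => indicator_nonneg
    (fun _ _ => mul_nonneg N.cast_nonneg (sub_nonneg.2 (hab i hi))) x

lemma sum_fibre_le_one (hN : 0 < N) (hab : ∀ i ∈ s, a i ≤ b i)
    (hdisj : (s : Set ι).PairwiseDisjoint fun i => Ioc (a i) (b i))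
    (hsub : ∀ i ∈ s, Ioc (a i) (b i) ⊆ Ioc ((l i : ℝ) / N) ((l i + 1 : ℕ) / N)) (j : ℕ) :
    ∑ i ∈ s with l i = j, N * (b i - a i) ≤ 1 := by
  have hN0 : (0:ℝ) < N := by exact_mod_cast hN
  have h := sum_length_le (s := s.filter fun i => l i = j) (a := a) (b := b)
    (c := (j:ℝ) / N) (d := (j + 1 : ℕ) / N) (by gcongr; simp)
    (fun i hi => hab i (Finset.mem_filter.1 hi).1)
    (hdisj.subset fun i hi => (Finset.mem_filter.1 hi).1) (fun i hi => by
      rw [Finset.mem_filter] at hi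
      rw [← hi.2]
      exact hsub i hi.1)
  rw [← Finset.mul_sum]
  calc (N:ℝ) * _ ≤ N * (((j + 1 : ℕ) : ℝ) / N - (j:ℝ) / N) := mul_le_mul_of_nonneg_left h hN0.le
    _ = 1 := by push_cast; field_simp; ring

lemma cellDensity_le_one (hN : 0 < N) (hab : ∀ i ∈ s, a i ≤ b i)
    (hdisj : (s : Set ι).PairwiseDisjoint fun i => Ioc (a i) (b i))
    (hsub : ∀ i ∈ s, Ioc (a i) (b i) ⊆ Ioc ((l i : ℝ) / N) ((l i + 1 : ℕ) / N)) (x : ℝ) :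
    cellDensity N s l a b x ≤ 1 := by
  have hN0 : (0:ℝ) < N := by exact_mod_cast hN
  refine le_trans ?_ (sum_fibre_le_one hN hab hdisj hsub ⌊N * x⌋₊)
  rw [Finset.sum_filter]
  refine Finset.sum_le_sum fun i hi => ?_
  have hnn : 0 ≤ N * (b i - a i) := mul_nonneg hN0.le (sub_nonneg.2 (hab i hi))
  by_cases hx : x ∈ Ico ((l i : ℝ) / N) ((l i + 1 : ℕ) / N)
  · rw [indicator_of_mem hx, if_pos]
    obtain ⟨h1, h2⟩ := hx
    rw [div_le_iff₀ hN0] at h1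
    rw [lt_div_iff₀ hN0] at h2
    push_cast at h2
    symm
    rw [Nat.floor_eq_iff ((Nat.cast_nonneg _).trans (by linarith : (l i : ℝ) ≤ N * x))]
    constructor <;> linarith
  · rw [indicator_of_notMem hx]
    split_ifs
    exacts [hnn, le_rfl]

lemma integral_cellDensity_mul (hN : 0 < N) (hl : ∀ i ∈ s, l i < N) {g : ℝ → ℝ}
    (hg : IntegrableOn g (Icc 0 1)) :
    ∫ x in Icc (0:ℝ) 1, cellDensity N s l a b x * g x =
      ∑ i ∈ s, N * (b i - a i) * ∫ x in ((l i : ℝ) / N)..((l i + 1 : ℕ) / N), g x := by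
  have hN0 : (0:ℝ) < N := by exact_mod_cast hN
  have e : ∀ i x, (Ico ((l i : ℝ) / N) ((l i + 1 : ℕ) / N)).indicator (fun _ => N * (b i - a i)) x
      * g x = N * (b i - a i) * (Ico ((l i : ℝ) / N) ((l i + 1 : ℕ) / N)).indicator g x := by
    intro i x
    by_cases hx : x ∈ Ico ((l i : ℝ) / N) ((l i + 1 : ℕ) / N)
    · rw [indicator_of_mem hx, indicator_of_mem hx]
    · rw [indicator_of_notMem hx, indicator_of_notMem hx, zero_mul, mul_zero]
  simp only [cellDensity, Finset.sum_mul, e]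
  rw [integral_finsetSum _ fun i _ => (hg.integrable.indicator measurableSet_Ico).const_mul _]
  refine Finset.sum_congr rfl fun i hi => ?_
  have hsub : Ico ((l i : ℝ) / N) ((l i + 1 : ℕ) / N) ⊆ Icc 0 1 := by
    refine Ico_subset_Icc_self.trans (Icc_subset_Icc (by positivity) ?_)
    rw [div_le_one hN0]
    exact_mod_cast hl i hi
  rw [integral_const_mul, integral_indicator measurableSet_Ico,
    Measure.restrict_restrict measurableSet_Ico, inter_eq_self_of_subset_left hsub,
    intervalIntegral.integral_of_le (by gcongr; simp), ← integral_Icc_eq_integral_Ioc,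
    integral_Icc_eq_integral_Ico]

lemma integral_cellDensity (hN : 0 < N) (hl : ∀ i ∈ s, l i < N) :
    ∫ x in Icc (0:ℝ) 1, cellDensity N s l a b x = ∑ i ∈ s, (b i - a i) := by
  have hN0 : (0:ℝ) < N := by exact_mod_cast hN
  have h := integral_cellDensity_mul (a := a) (b := b) hN hl (g := fun _ => 1) (by simp)
  simp only [mul_one] at h
  rw [h]
  refine Finset.sum_congr rfl fun i _ => ?_
  simp only [intervalIntegral.integral_const, smul_eq_mul]
  push_cast
  field_simp
  ring

end cellDensity

lemma abs_sum_sub_integral_cellDensity_le {f : ℝ → X} {w : X} {δ : ℝ → ℝ} {ε : ℝ} (hδ : IsGauge δ)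
    (h : ∀ (n : ℕ) (P : TP n), P.IsPerron → P.IsFine δ → ‖w - fSum P f‖ < ε)
    {x' : X →L[ℝ] ℝ} (hx' : ‖x'‖ ≤ 1) (hf : IntegrableOn (fun t => x' (f t)) (Icc 0 1))
    (hw : x' w = ∫ t in (0:ℝ)..1, x' (f t)) {ι : Type*} {N : ℕ} (hN : 0 < N) {s : Finset ι}
    {l : ι → ℕ} {a b t : ι → ℝ} (hab : ∀ i ∈ s, a i ≤ b i)
    (hdisj : (s : Set ι).PairwiseDisjoint fun i => Ioc (a i) (b i))
    (hsub : ∀ i ∈ s, Ioc (a i) (b i) ⊆ Ioc ((l i : ℝ) / N) ((l i + 1 : ℕ) / N))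
    (ht : ∀ i ∈ s, l i < N ∧ t i ∈ Icc ((l i:ℝ) / N) ((l i + 1 : ℕ) / N) ∧
      1 / (N:ℝ) < δ (t i)) :
    |∑ i ∈ s, (b i - a i) * x' (f (t i)) -
      ∫ x in Icc (0:ℝ) 1, cellDensity N s l a b x * x' (f x)| ≤ ε := by
  classical
  have hN0 : (0:ℝ) < N := by exact_mod_cast hN
  rw [integral_cellDensity_mul hN (fun i hi => (ht i hi).1) hf, ← Finset.sum_sub_distrib]
  set v : ι → ℝ := fun i =>
    1 / N * x' (f (t i)) - ∫ x in ((l i : ℝ) / N)..((l i + 1 : ℕ) / N), x' (f x) with hv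
  have e : ∀ i ∈ s, (b i - a i) * x' (f (t i)) -
      N * (b i - a i) * ∫ x in ((l i : ℝ) / N)..((l i + 1 : ℕ) / N), x' (f x) =
      N * (b i - a i) * v i := by
    intro i _
    simp only [hv]
    field_simp
  rw [Finset.sum_congr rfl e]
  have hα : ∀ i ∈ s, 0 ≤ N * (b i - a i) := fun i hi =>
    mul_nonneg hN0.le (sub_nonneg.2 (hab i hi))
  have hfib := sum_fibre_le_one hN hab hdisj hsub
  have hsel : ∀ T ⊆ s, Set.InjOn l T → |∑ i ∈ T, v i| ≤ ε := by
    intro T hT hinj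
    rcases isEmpty_or_nonempty ι with hι | hι
    · have hT0 : T = ∅ := Finset.eq_empty_of_isEmpty T
      have := abs_sum_mesh_le hδ h hx' hf hw hN (S := ∅) (τ := 0) (by simp)
      simpa [hT0] using this
    have hinv : ∀ i ∈ T, Function.invFunOn l T (l i) = i := fun i hi =>
      hinj.leftInvOn_invFunOn hi
    have := abs_sum_mesh_le hδ h hx' hf hw hN (S := T.image l)
      (τ := fun j => t (Function.invFunOn l T j)) (by
        intro j hj
        obtain ⟨i, hi, rfl⟩ := Finset.mem_image.1 hj
        rw [hinv i hi]
        exact ht i (hT hi))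
    rw [Finset.sum_image hinj] at this
    convert this using 3 with i hi
    rw [hinv i hi]
  rw [abs_le]
  constructor
  · have := sum_mul_le_of_selection (v := fun i => -v i) hα hfib fun T hT hinj => by
      rw [Finset.sum_neg_distrib]
      exact (neg_le_abs _).trans (hsel T hT hinj)
    simp only [mul_neg, Finset.sum_neg_distrib] at this
    linarith
  · exact sum_mul_le_of_selection hα hfib fun T hT hinj =>
      (le_abs_self _).trans (hsel T hT hinj)

/-- Riemann sums of `f` over disjoint intervals tagged in `C` and fine with respect to the mesh
`ℤ / N` are, uniformly over the dual unit ball, `ε`-close to integrals against a density which is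
concentrated on `C` up to `η`. -/
def IsLevel (f : ℝ → X) (ε η : ℝ) (C : Set ℝ) (N : ℕ) : Prop :=
  ∀ (n : ℕ) (s : Finset (Fin n)) (a b t : Fin n → ℝ), (∀ i ∈ s, a i ≤ b i) →
    (s : Set (Fin n)).PairwiseDisjoint (fun i => Ioc (a i) (b i)) →
    (∀ i ∈ s, t i ∈ C ∧
      Icc (a i) (b i) ⊆ Ioo (t i - meshGauge N (t i)) (t i + meshGauge N (t i))) →
    ∃ φ : ℝ → ℝ, Measurable φ ∧ (∀ x, 0 ≤ φ x) ∧ (∀ x, φ x ≤ 1) ∧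
      ∫ x in Icc (0:ℝ) 1, φ x = ∑ i ∈ s, (b i - a i) ∧
      ∫ x in Icc (0:ℝ) 1, Cᶜ.indicator φ x ≤ η ∧
      ∀ x' : X →L[ℝ] ℝ, ‖x'‖ ≤ 1 →
        |∑ i ∈ s, (b i - a i) * x' (f (t i)) - ∫ x in Icc (0:ℝ) 1, φ x * x' (f x)| ≤ ε

lemma exists_isLevel {f : ℝ → X} {w : X} {ε η : ℝ} {κ : ℝ≥0∞} {R : Set ℝ}
    (hH : ∃ δ : ℝ → ℝ, IsGauge δ ∧ AEMeasurable δ volume ∧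
      ∀ (n : ℕ) (P : TP n), P.IsPerron → P.IsFine δ → ‖w - fSum P f‖ < ε)
    (hf : ∀ x' : X →L[ℝ] ℝ, IntegrableOn (fun t => x' (f t)) (Icc 0 1))
    (hw : ∀ x' : X →L[ℝ] ℝ, x' w = ∫ t in (0:ℝ)..1, x' (f t))
    (hη : 0 < η) (hκ : 0 < κ) (hR : MeasurableSet R) (hR1 : R ⊆ Icc 0 1) :
    ∃ C ⊆ R, IsCompact C ∧ volume (R \ C) < κ ∧ ∃ N : ℕ, 0 < N ∧ IsLevel f ε η C N := by
  obtain ⟨δ, hδ, hδm, h⟩ := hH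
  obtain ⟨C, hCR, hC, hCκ, c, hc, hcδ⟩ := exists_isCompact_gauge_gt hδ hδm hR hR1 hκ
  obtain ⟨N, hN, hNc, hNη⟩ := exists_mesh_cthickening_lt hC hc hη
  refine ⟨C, hCR, hC, hCκ, N, hN, fun n s a b t hab hdisj ht => ?_⟩
  have hcell := fun i hi =>
    cell_of_meshGauge hN (hR1 (hCR (ht i hi).1)) (hab i hi) (ht i hi).2
  have hsub : ∀ i ∈ s, Ioc (a i) (b i) ⊆
      Ioc ((⌊N * t i⌋₊ : ℝ) / N) ((⌊N * t i⌋₊ + 1 : ℕ) / N) := fun i hi =>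
    Ioc_subset_Icc_self.trans ((hcell i hi).2.2.trans Ioo_subset_Ioc_self)
  set φ := cellDensity N s (fun i => ⌊N * t i⌋₊) a b with hφ
  have hφ0 : ∀ x, 0 ≤ φ x := cellDensity_nonneg hab
  have hφ1 : ∀ x, φ x ≤ 1 := cellDensity_le_one hN hab hdisj hsub
  have hφm : Measurable φ := measurable_cellDensity
  refine ⟨φ, hφm, hφ0, hφ1, integral_cellDensity hN fun i hi => (hcell i hi).1, ?_,
    fun x' hx' => ?_⟩
  · have hsupp : ∀ x, Cᶜ.indicator φ x ≤ (cthickening (1 / (N:ℝ)) C \ C).indicator 1 x := by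
      intro x
      by_cases hx : x ∈ C
      · rw [indicator_of_notMem (not_not.2 hx), indicator_of_notMem fun h : x ∈ _ \ C => h.2 hx]
      by_cases hx' : x ∈ cthickening (1 / (N:ℝ)) C
      · rw [indicator_of_mem hx, indicator_of_mem (show x ∈ _ \ C from ⟨hx', hx⟩)]
        exact hφ1 x
      · rw [indicator_of_mem hx, indicator_of_notMem fun h : x ∈ _ \ C => hx' h.1, hφ]
        refine (Finset.sum_eq_zero fun i hi => indicator_of_notMem (fun hxi => hx' ?_) _).le
        refine mem_cthickening_of_dist_le x (t i) _ _ (ht i hi).1 ?_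
        obtain ⟨-, ⟨h1, h2⟩, -⟩ := hcell i hi
        obtain ⟨h3, h4⟩ := hxi
        have e : ((⌊N * t i⌋₊ + 1 : ℕ) : ℝ) / N = (⌊N * t i⌋₊ : ℝ) / N + 1 / N := by
          push_cast; ring
        rw [e] at h2 h4
        rw [Real.dist_eq, abs_le]
        constructor <;> linarith
    have hS : MeasurableSet (cthickening (1 / (N:ℝ)) C \ C) :=
      isClosed_cthickening.measurableSet.diff hC.measurableSet
    refine (integral_mono_of_nonneg (Eventually.of_forall
      (indicator_nonneg fun x _ => hφ0 x)) ?_ (Eventually.of_forall hsupp)).trans ?_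
    · exact (integrable_const (1:ℝ)).indicator hS
    · rw [integral_indicator_one hS, measureReal_restrict_apply hS]
      exact (measureReal_mono inter_subset_left
        ((measure_mono sdiff_subset).trans_lt hC.cthickening.measure_lt_top).ne).trans hNη
  · exact abs_sum_sub_integral_cellDensity_le hδ h hx' (hf x') (hw x') hN hab hdisj hsub
      fun i hi => ⟨(hcell i hi).1, (hcell i hi).2.1, hNc.trans (hcδ _ (ht i hi).1)⟩

lemma exists_isLevel_seq {f : ℝ → X} {w : X} {e η : ℕ → ℝ} (he : ∀ n, 0 < e n) (hη : ∀ n, 0 < η n)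
    (hH : ∀ ε > 0, ∃ δ : ℝ → ℝ, IsGauge δ ∧ AEMeasurable δ volume ∧
      ∀ (n : ℕ) (P : TP n), P.IsPerron → P.IsFine δ → ‖w - fSum P f‖ < ε)
    (hf : ∀ x' : X →L[ℝ] ℝ, IntegrableOn (fun t => x' (f t)) (Icc 0 1))
    (hw : ∀ x' : X →L[ℝ] ℝ, x' w = ∫ t in (0:ℝ)..1, x' (f t)) :
    ∃ (C : ℕ → Set ℝ) (N : ℕ → ℕ),
      (∀ n, MeasurableSet (C n) ∧ 0 < N n ∧ IsLevel f (e n) (η n) (C n) (N n)) ∧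
      Pairwise (Function.onFun Disjoint C) ∧ volume (Icc (0:ℝ) 1 \ ⋃ n, C n) = 0 := by
  have hex : ∀ (n : ℕ) (R : {R : Set ℝ // MeasurableSet R ∧ R ⊆ Icc 0 1}),
      ∃ C ⊆ R.1, IsCompact C ∧ volume (R.1 \ C) < 2⁻¹ ^ n ∧
        ∃ N : ℕ, 0 < N ∧ IsLevel f (e n) (η n) C N := fun n R =>
    exists_isLevel (hH _ (he n)) hf hw (hη n) (ENNReal.pow_pos (by simp) n) R.2.1 R.2.2
  choose C hCR hC hCκ N hN hlev using hex
  let R : ℕ → {R : Set ℝ // MeasurableSet R ∧ R ⊆ Icc 0 1} := fun n =>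
    Nat.rec ⟨Icc 0 1, measurableSet_Icc, Subset.rfl⟩
      (fun n R => ⟨R.1 \ C n R, R.2.1.diff (hC n R).measurableSet, sdiff_subset.trans R.2.2⟩) n
  have hR : ∀ n, (R (n + 1)).1 = (R n).1 \ C n (R n) := fun n => rfl
  have hanti : Antitone fun n => (R n).1 := antitone_nat_of_succ_le fun n => by
    rw [hR]; exact sdiff_subset
  refine ⟨fun n => C n (R n), fun n => N n (R n), fun n => ⟨(hC n _).measurableSet, hN n _,
    hlev n _⟩, ?_, ?_⟩
  · refine (pairwise_disjoint_on _).2 fun n m hnm => ?_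
    refine disjoint_left.2 fun x hx hxm => ?_
    have h1 := hanti (Nat.succ_le_of_lt hnm) (hCR m _ hxm)
    exact h1.2 hx
  · have h1 : ∀ n, Icc (0:ℝ) 1 \ ⋃ n, C n (R n) ⊆ (R n).1 := by
      intro n
      induction n with
      | zero => exact sdiff_subset
      | succ n ih =>
        intro x hx
        exact ⟨ih hx, fun h => hx.2 (mem_iUnion.2 ⟨n, h⟩)⟩
    have h2 : Tendsto (fun n : ℕ => (2⁻¹ : ℝ≥0∞) ^ n) atTop (𝓝 0) :=
      ENNReal.tendsto_pow_atTop_nhds_zero_of_lt_one (by simp)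
    refine le_antisymm (ge_of_tendsto' h2 fun n => ?_) zero_le
    exact (measure_mono (h1 (n + 1))).trans (hCκ n _).le

lemma exists_gauge_sum_null_le {Z : Set ℝ} (hZ : volume Z = 0) (k : ℝ → ℝ) {ζ : ℝ} (hζ : 0 < ζ) :
    ∃ δZ : ℝ → ℝ, (∀ t, 0 < δZ t) ∧ ∀ δ : ℝ → ℝ, (∀ t ∈ Z, δ t = δZ t) →
      ∀ (n : ℕ) (P : TP n), P.IsFine δ → ∑ i, P.len i * Z.indicator k (P.tag i) ≤ ζ := by
  have hk0 : Z.indicator k =ᵐ[volume] 0 := indicator_meas_zero hZ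
  have hki : Integrable (Z.indicator k) := (integrable_zero _ _ _).congr hk0.symm
  obtain ⟨u, hu, hku, hint, δZ, hδZ, h⟩ := exists_gauge_le_integral hki hζ
  have hu0 : 0 ≤ᵐ[volume] u := hk0.symm.le.trans hku
  refine ⟨δZ, hδZ, fun δ hδ n P hP => ?_⟩
  have h1 := (fSum_riemannSum P hP (Z.indicator k)).apply_le_integral
    (ContinuousLinearMap.id ℝ ℝ) hu fun p q t hpq hD => by
      by_cases ht : t ∈ Z
      · exact h t p q hpq (hδ t ht ▸ hD.2)
      · simpa [ht] using intervalIntegral.integral_nonneg_of_ae hpq hu0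
  rw [integral_congr_ae hk0] at hint
  simp only [Pi.zero_apply, integral_zero, zero_add] at hint
  refine le_trans h1 (le_trans ?_ hint)
  rw [intervalIntegral.integral_of_le zero_le_one]
  exact setIntegral_le_integral hu hu0

lemma TP.pairwiseDisjoint_Ioc {n : ℕ} (P : TP n) (s : Set (Fin n)) :
    s.PairwiseDisjoint fun i => Ioc (P.pt i.castSucc) (P.pt i.succ) := by
  have key : ∀ i j : Fin n, i < j →
      Disjoint (Ioc (P.pt i.castSucc) (P.pt i.succ)) (Ioc (P.pt j.castSucc) (P.pt j.succ)) :=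
    fun i j hij => Ioc_disjoint_Ioc_of_le (P.mono (Fin.succ_le_castSucc_iff.2 hij))
  intro i _ j _ hij
  rcases lt_or_gt_of_ne hij with h | h
  · exact key i j h
  · exact (key j i h).symm

lemma TP.sum_len {n : ℕ} (P : TP n) : ∑ i, P.len i = 1 := by
  have h := (Fin.sum_univ_succ P.pt).symm.trans (Fin.sum_univ_castSucc P.pt)
  simp only [TP.len, Finset.sum_sub_distrib]
  rw [P.first, P.last] at h
  linarith

lemma sum_indicator_le_one {C : ℕ → Set ℝ} (hC : Pairwise (Function.onFun Disjoint C))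
    {φ : ℕ → ℝ → ℝ} (hφ : ∀ n x, φ n x ≤ 1) (L : ℕ) (x : ℝ) :
    ∑ n ∈ Finset.range L, (C n).indicator (φ n) x ≤ 1 := by
  by_cases h : ∃ n ∈ Finset.range L, x ∈ C n
  · obtain ⟨n, hn, hx⟩ := h
    rw [Finset.sum_eq_single_of_mem n hn fun m _ hmn => indicator_of_notMem
      (fun hm => disjoint_left.1 (hC hmn) hm hx) _, indicator_of_mem hx]
    exact hφ n x
  · push Not at h
    rw [Finset.sum_eq_zero fun n hn => indicator_of_notMem (h n hn) _]
    exact zero_le_one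

lemma sum_half_pow_le {a : ℝ} (ha : 0 ≤ a) (L : ℕ) :
    ∑ n ∈ Finset.range L, a / 2 / 2 ^ n ≤ a := by
  have := (summable_geometric_two' a).sum_le_tsum (Finset.range L) fun n _ => by positivity
  rwa [tsum_geometric_two'] at this

lemma exists_aemeasurable_gauge {C : ℕ → Set ℝ} {N : ℕ → ℕ} (hC : ∀ n, MeasurableSet (C n))
    (hN : ∀ n, 0 < N n) (hdisj : Pairwise (Function.onFun Disjoint C)) {Z : Set ℝ}
    (hZ : volume Z = 0) (hCZ : ∀ t ∈ Icc (0:ℝ) 1, t ∉ Z → Irrational t ∧ t ∈ ⋃ n, C n)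
    {δZ : ℝ → ℝ} (hδZ : ∀ t, 0 < δZ t) :
    ∃ δ : ℝ → ℝ, IsGauge δ ∧ AEMeasurable δ volume ∧ (∀ t ∈ Z, δ t = δZ t) ∧
      ∀ n, ∀ t ∈ C n, t ∉ Z → δ t = meshGauge (N n) t := by
  classical
  obtain ⟨F, hF, hFC⟩ := exists_measurable_piecewise C hC (fun n => meshGauge (N n))
    (fun n => measurable_meshGauge _) fun i j hij t ht =>
      absurd ht.2 (disjoint_left.1 (hdisj hij) ht.1)
  have hδ : ∀ n, ∀ t ∈ C n, t ∉ Z → Z.piecewise δZ F t = meshGauge (N n) t := fun n t ht htZ => by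
    rw [piecewise_eq_of_notMem _ _ _ htZ, hFC n ht]
  refine ⟨Z.piecewise δZ F, fun t ht => ?_, ⟨F, hF, ?_⟩,
    fun t ht => piecewise_eq_of_mem _ _ _ ht, hδ⟩
  · by_cases htZ : t ∈ Z
    · rw [piecewise_eq_of_mem _ _ _ htZ]
      exact hδZ t
    · obtain ⟨hirr, hU⟩ := hCZ t ht htZ
      obtain ⟨n, hn⟩ := mem_iUnion.1 hU
      rw [hδ n t hn htZ]
      exact meshGauge_pos (hN n) hirr
  · filter_upwards [compl_mem_ae_iff.2 hZ] with t ht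
    exact piecewise_eq_of_notMem _ _ _ ht

/-- Comparison of an integral with a sum of integrals against densities which are almost
concentrated on disjoint sets. -/
lemma abs_integral_sub_sum_le {μ : Measure ℝ} [IsProbabilityMeasure μ] {g : ℝ → ℝ}
    (hg : Integrable g μ) {C : ℕ → Set ℝ} (hC : ∀ n, MeasurableSet (C n))
    (hdisj : Pairwise (Function.onFun Disjoint C)) {φ : ℕ → ℝ → ℝ} (hφm : ∀ n, Measurable (φ n))
    (hφ0 : ∀ n x, 0 ≤ φ n x) (hφ1 : ∀ n x, φ n x ≤ 1) {V e η : ℕ → ℝ} {L : ℕ} {ε η₀ : ℝ}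
    (hV : ∀ n, |V n - ∫ x, φ n x * g x ∂μ| ≤ e n)
    (hη : ∀ n, ∫ x, (C n)ᶜ.indicator (φ n) x ∂μ ≤ η n)
    (he : ∀ n, |∫ x, (C n)ᶜ.indicator (φ n) x * g x ∂μ| ≤ e n)
    (hmass : 1 - ∑ n ∈ Finset.range L, ∫ x, φ n x ∂μ + ∑ n ∈ Finset.range L, η n ≤ η₀)
    (hUI : ∀ ψ : ℝ → ℝ, Measurable ψ → (∀ t, 0 ≤ ψ t) → (∀ t, ψ t ≤ 1) →
      ∫ t, ψ t ∂μ ≤ η₀ → |∫ t, ψ t * g t ∂μ| ≤ ε) :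
    |∫ x, g x ∂μ - ∑ n ∈ Finset.range L, V n| ≤ ε + 2 * ∑ n ∈ Finset.range L, e n := by
  set ψ : ℝ → ℝ := fun x => ∑ n ∈ Finset.range L, (C n).indicator (φ n) x with hψ
  have hCm : ∀ n, Measurable ((C n).indicator (φ n)) := fun n => (hφm n).indicator (hC n)
  have hCm' : ∀ n, Measurable ((C n)ᶜ.indicator (φ n)) := fun n => (hφm n).indicator (hC n).compl
  have hψm : Measurable ψ := Finset.measurable_sum _ fun n _ => hCm n
  have hC0 : ∀ n x, 0 ≤ (C n).indicator (φ n) x := fun n x =>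
    indicator_nonneg (fun x _ => hφ0 n x) x
  have hC0' : ∀ n x, 0 ≤ (C n)ᶜ.indicator (φ n) x := fun n x =>
    indicator_nonneg (fun x _ => hφ0 n x) x
  have hsplit : ∀ n x, (C n).indicator (φ n) x = φ n x - (C n)ᶜ.indicator (φ n) x := fun n x => by
    rw [eq_sub_iff_add_eq, ← Pi.add_apply, indicator_self_add_compl]
  have hC1' : ∀ n x, (C n)ᶜ.indicator (φ n) x ≤ 1 := fun n x => by
    linarith [hsplit n x, hC0 n x, hφ1 n x]
  have hψ0 : ∀ x, 0 ≤ ψ x := fun x => Finset.sum_nonneg fun n _ => hC0 n x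
  have hψ1 : ∀ x, ψ x ≤ 1 := sum_indicator_le_one hdisj hφ1 L
  have hint : ∀ {θ : ℝ → ℝ}, Measurable θ → (∀ x, 0 ≤ θ x) → (∀ x, θ x ≤ 1) → Integrable θ μ :=
    fun hm h0 h1 => Integrable.of_bound hm.aestronglyMeasurable 1
      (Eventually.of_forall fun t => by rw [Real.norm_of_nonneg (h0 t)]; exact h1 t)
  have hintg : ∀ {θ : ℝ → ℝ}, Measurable θ → (∀ x, 0 ≤ θ x) → (∀ x, θ x ≤ 1) →
      Integrable (fun x => θ x * g x) μ :=
    fun hm h0 h1 => hg.bdd_mul (c := 1) hm.aestronglyMeasurable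
      (Eventually.of_forall fun t => by rw [Real.norm_of_nonneg (h0 t)]; exact h1 t)
  have e1 : ∫ x, ψ x ∂μ = ∑ n ∈ Finset.range L, (∫ x, φ n x ∂μ -
      ∫ x, (C n)ᶜ.indicator (φ n) x ∂μ) := by
    simp only [hψ, hsplit]
    have hi : ∀ n, Integrable (fun x => φ n x - (C n)ᶜ.indicator (φ n) x) μ := fun n =>
      (hint (hφm n) (hφ0 n) (hφ1 n)).sub (hint (hCm' n) (hC0' n) (hC1' n))
    rw [integral_finsetSum _ fun n _ => hi n]
    exact Finset.sum_congr rfl fun n _ => integral_sub (hint (hφm n) (hφ0 n) (hφ1 n))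
      (hint (hCm' n) (hC0' n) (hC1' n))
  have e2 : ∫ x, ψ x * g x ∂μ = ∑ n ∈ Finset.range L, (∫ x, φ n x * g x ∂μ -
      ∫ x, (C n)ᶜ.indicator (φ n) x * g x ∂μ) := by
    simp only [hψ, hsplit, Finset.sum_mul, sub_mul]
    have hi : ∀ n, Integrable (fun x => φ n x * g x - (C n)ᶜ.indicator (φ n) x * g x) μ :=
      fun n => (hintg (hφm n) (hφ0 n) (hφ1 n)).sub (hintg (hCm' n) (hC0' n) (hC1' n))
    rw [integral_finsetSum _ fun n _ => hi n]
    exact Finset.sum_congr rfl fun n _ => integral_sub (hintg (hφm n) (hφ0 n) (hφ1 n))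
      (hintg (hCm' n) (hC0' n) (hC1' n))
  have e3 : ∫ x, g x ∂μ = ∫ x, (1 - ψ x) * g x ∂μ + ∫ x, ψ x * g x ∂μ := by
    rw [← integral_add (hintg (hψm.const_sub 1) (fun x => sub_nonneg.2 (hψ1 x))
      fun x => sub_le_self _ (hψ0 x)) (hintg hψm hψ0 hψ1)]
    exact integral_congr_ae (Eventually.of_forall fun x => by ring)
  have b1 : |∫ x, (1 - ψ x) * g x ∂μ| ≤ ε := by
    refine hUI _ (hψm.const_sub 1) (fun x => sub_nonneg.2 (hψ1 x))
      (fun x => sub_le_self _ (hψ0 x)) (le_trans ?_ hmass)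
    rw [integral_sub (integrable_const _) (hint hψm hψ0 hψ1), e1, Finset.sum_sub_distrib]
    have := Finset.sum_le_sum fun n (_ : n ∈ Finset.range L) => hη n
    simp only [integral_const, probReal_univ, smul_eq_mul, mul_one]
    linarith
  have b2 : |∫ x, ψ x * g x ∂μ - ∑ n ∈ Finset.range L, V n| ≤ ∑ n ∈ Finset.range L, 2 * e n := by
    rw [e2, ← Finset.sum_sub_distrib]
    refine (Finset.abs_sum_le_sum_abs _ _).trans (Finset.sum_le_sum fun n _ => ?_)
    have h1 := abs_le.1 (hV n)
    have h2 := abs_le.1 (he n)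
    rw [abs_le]
    constructor <;> linarith [h1.1, h1.2, h2.1, h2.2]
  rw [← Finset.mul_sum] at b2
  rw [e3]
  calc _ = |∫ x, (1 - ψ x) * g x ∂μ + (∫ x, ψ x * g x ∂μ - ∑ n ∈ Finset.range L, V n)| := by
        congr 1; ring
    _ ≤ _ := (abs_add_le _ _).trans (add_le_add b1 b2)

theorem birkhoffIntegrable_of_hMeas_of_pettis [CompleteSpace X] {f : ℝ → X}
    (hH : FHMeasIntegrable f) (hp : FPettisIntegrable f) : FBirkhoffIntegrable f := by
  obtain ⟨w, hH⟩ := hH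
  have hw : ∀ x' : X →L[ℝ] ℝ, x' w = ∫ t in (0:ℝ)..1, x' (f t) := fun x' =>
    apply_eq_integral_of_perron x' (hp.1 x') fun ε hε => by
      obtain ⟨δ, hδ, -, h⟩ := hH ε hε
      exact ⟨δ, hδ, h⟩
  refine ⟨w, fun ε hε => ?_⟩
  have hε8 : 0 < ε / 8 := by positivity
  obtain ⟨η₀, hη₀, hUI₀⟩ := hp.weighted hε8
  set e : ℕ → ℝ := fun n => ε / 8 / 2 / 2 ^ n with he
  have hepos : ∀ n, 0 < e n := fun n => by positivity
  choose η₁ hη₁ hUI₁ using fun n => hp.weighted (hepos n)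
  set η : ℕ → ℝ := fun n => min (η₁ n) (η₀ / 2 / 2 / 2 ^ n) with hη
  have hηpos : ∀ n, 0 < η n := fun n => lt_min (hη₁ n) (by positivity)
  obtain ⟨C, N, hCN, hdisj, hC0⟩ := exists_isLevel_seq hepos hηpos hH hp.1 hw
  set Z : Set ℝ := (Icc (0:ℝ) 1 \ ⋃ n, C n) ∪ range ((↑) : ℚ → ℝ) with hZdef
  have hZ : volume Z = 0 := measure_union_null hC0 ((countable_range _).measure_zero _)
  have hCZ : ∀ t ∈ Icc (0:ℝ) 1, t ∉ Z → Irrational t ∧ t ∈ ⋃ n, C n := fun t ht htZ =>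
    ⟨fun h => htZ (Or.inr h), by_contra fun h => htZ (Or.inl ⟨ht, h⟩)⟩
  obtain ⟨δZ, hδZ, hZsum⟩ := exists_gauge_sum_null_le hZ (fun t => ‖f t‖ + 1)
    (lt_min (half_pos hη₀) hε8)
  obtain ⟨δ, hδ, hδm, hδZ', hδC⟩ := exists_aemeasurable_gauge (fun n => (hCN n).1)
    (fun n => (hCN n).2.1) hdisj hZ hCZ hδZ
  refine ⟨δ, hδ, hδm, fun m P hP => ?_⟩
  obtain ⟨x', hx', hxn⟩ := exists_dual_vector'' ℝ (w - fSum P f)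
  have hxn' : x' (w - fSum P f) = ‖w - fSum P f‖ := hxn
  rw [← hxn', map_sub]
  have : IsProbabilityMeasure (volume.restrict (Icc (0:ℝ) 1)) := ⟨by simp⟩
  have hlev : ∀ t, ∃ n, t ∈ Icc (0:ℝ) 1 → t ∉ Z → t ∈ C n := fun t => by
    by_cases h : t ∈ ⋃ n, C n
    · obtain ⟨n, hn⟩ := mem_iUnion.1 h
      exact ⟨n, fun _ _ => hn⟩
    · exact ⟨0, fun ht htZ => absurd (hCZ t ht htZ).2 h⟩
  choose lev hlev using hlev
  classical
  set S : Finset (Fin m) := Finset.univ.filter fun i => P.tag i ∉ Z with hS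
  set L : ℕ := (Finset.univ.sup fun i => lev (P.tag i)) + 1 with hL
  have hmaps : ∀ i ∈ S, lev (P.tag i) ∈ Finset.range L := fun i _ =>
    Finset.mem_range.2 (Nat.lt_succ_of_le
      (Finset.le_sup (f := fun i => lev (P.tag i)) (Finset.mem_univ i)))
  set s : ℕ → Finset (Fin m) := fun n => S.filter fun i => lev (P.tag i) = n with hs
  have hle : ∀ i : Fin m, P.pt i.castSucc ≤ P.pt i.succ := fun i =>
    P.mono (Fin.castSucc_lt_succ (i := i)).le
  have hsn : ∀ n, ∀ i ∈ s n, P.tag i ∈ C n ∧ Icc (P.pt i.castSucc) (P.pt i.succ) ⊆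
      Ioo (P.tag i - meshGauge (N n) (P.tag i)) (P.tag i + meshGauge (N n) (P.tag i)) := by
    intro n i hi
    obtain ⟨hiS, rfl⟩ := Finset.mem_filter.1 hi
    have hiZ := (Finset.mem_filter.1 hiS).2
    have hiC := hlev (P.tag i) (P.tagMem i) hiZ
    refine ⟨hiC, ?_⟩
    rw [← hδC _ _ hiC hiZ]
    exact hP i
  choose φ hφm hφ0 hφ1 hφint hφη hφe using fun n => (hCN n).2.2 m (s n) (fun i => P.pt i.castSucc)
    (fun i => P.pt i.succ) P.tag (fun i _ => hle i) (P.pairwiseDisjoint_Ioc _) (hsn n)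
  have hfib : ∀ v : Fin m → ℝ, ∑ n ∈ Finset.range L, ∑ i ∈ s n, v i +
      ∑ i with P.tag i ∈ Z, v i = ∑ i, v i := fun v => by
    rw [Finset.sum_fiberwise_of_maps_to hmaps, add_comm]
    exact Finset.sum_filter_add_sum_filter_not _ _ _
  have hZle : ∑ i with P.tag i ∈ Z, P.len i * (‖f (P.tag i)‖ + 1) ≤ min (η₀ / 2) (ε / 8) := by
    refine le_trans (le_of_eq ?_) (hZsum δ hδZ' m P hP)
    rw [Finset.sum_filter]
    refine Finset.sum_congr rfl fun i _ => ?_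
    by_cases hi : P.tag i ∈ Z <;> simp [hi]
  have hlen0 : ∀ i, 0 ≤ P.len i := fun i => sub_nonneg.2 (hle i)
  have hZlen : ∑ i with P.tag i ∈ Z, P.len i ≤ η₀ / 2 := by
    refine le_trans (Finset.sum_le_sum fun i _ => ?_) (hZle.trans (min_le_left _ _))
    exact le_mul_of_one_le_right (hlen0 i) (by linarith [norm_nonneg (f (P.tag i))])
  have hZval : |∑ i with P.tag i ∈ Z, P.len i * x' (f (P.tag i))| ≤ ε / 8 := by
    refine (Finset.abs_sum_le_sum_abs _ _).trans
      (le_trans (Finset.sum_le_sum fun i _ => ?_) (hZle.trans (min_le_right _ _)))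
    rw [abs_mul, abs_of_nonneg (hlen0 i)]
    refine mul_le_mul_of_nonneg_left ?_ (hlen0 i)
    have := x'.le_of_opNorm_le hx' (f (P.tag i))
    rw [Real.norm_eq_abs, one_mul] at this
    linarith
  have hηle : ∀ n, η n ≤ η₀ / 2 / 2 / 2 ^ n := fun n => min_le_right _ _
  have hmain := abs_integral_sub_sum_le (hp.1 x') (fun n => (hCN n).1) hdisj hφm hφ0 hφ1
    (L := L) (ε := ε / 8) (η₀ := η₀) (fun n => hφe n x' hx') hφη
    (fun n => hUI₁ n _ ((hφm n).indicator (hCN n).1.compl)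
      (indicator_nonneg fun x _ => hφ0 n x)
      (fun x => (indicator_le_self' (fun y _ => hφ0 n y) x).trans (hφ1 n x))
      ((hφη n).trans (min_le_left _ _)) x' hx') (by
      have h1 : ∑ n ∈ Finset.range L, ∫ x in Icc (0:ℝ) 1, φ n x =
          ∑ n ∈ Finset.range L, ∑ i ∈ s n, P.len i := Finset.sum_congr rfl fun n _ => hφint n
      have h2 := hfib P.len
      rw [P.sum_len] at h2
      have h3 := (Finset.sum_le_sum fun n (_ : n ∈ Finset.range L) => hηle n).trans
        (sum_half_pow_le (half_pos hη₀).le L)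
      rw [h1]
      linarith) (fun ψ h1 h2 h3 h4 => hUI₀ ψ h1 h2 h3 h4 x' hx')
  have h4 := sum_half_pow_le hε8.le L
  have h5 := hfib fun i => P.len i * x' (f (P.tag i))
  have h6 : x' (fSum P f) = ∑ i, P.len i * x' (f (P.tag i)) := by
    simp [fSum, map_sum]
  rw [hw, h6, ← h5, intervalIntegral.integral_of_le zero_le_one, ← integral_Icc_eq_integral_Ioc]
  rw [abs_le] at hmain hZval
  have h7 : ∑ n ∈ Finset.range L, e n ≤ ε / 8 := h4
  change _ - (∑ n ∈ Finset.range L, ∑ i ∈ s n,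
    (P.pt i.succ - P.pt i.castSucc) * x' (f (P.tag i)) + _) < ε
  linarith [hmain.2, hZval.1]

/-! ### Birkhoff integrable functions are Pettis integrable -/

/-- A partition of `[0, 1]` has a refinement of arbitrarily small mesh. -/
lemma exists_refinement {p : ℕ → ℝ} (hp : Monotone p) {n : ℕ} (h0 : p 0 = 0) (hn : p n = 1)
    {c : ℝ} (hc : 0 < c) : ∃ (M : ℕ) (q : ℕ → ℝ) (r : ℕ → ℕ), Monotone q ∧ q 0 = 0 ∧ q M = 1 ∧
      ∀ k < M, r k < n ∧ q (k + 1) - q k ≤ c ∧ p (r k) ≤ q k ∧ q (k + 1) ≤ p (r k + 1) := by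
  obtain ⟨m, hm⟩ := exists_nat_one_div_lt hc
  set N := m + 1 with hN
  have hN0 : 0 < N := Nat.succ_pos m
  have hNr : (0:ℝ) < N := by exact_mod_cast hN0
  set q : ℕ → ℝ := fun k => p (k / N) + ((k % N : ℕ) : ℝ) / N * (p (k / N + 1) - p (k / N)) with hq
  have hstep : ∀ k, q (k + 1) =
      p (k / N) + (((k % N : ℕ) : ℝ) + 1) / N * (p (k / N + 1) - p (k / N)) := by
    intro k
    have hlt := Nat.mod_lt k hN0
    have hk := Nat.div_add_mod k N
    rcases Nat.lt_or_ge (k % N + 1) N with h | h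
    · obtain ⟨h1, h2⟩ := (Nat.div_mod_unique hN0 (a := k + 1) (c := k % N + 1) (d := k / N)).2
        ⟨by omega, h⟩
      simp only [hq, h1, h2]
      push_cast
      ring
    · have h3 : k % N + 1 = N := by omega
      obtain ⟨h1, h2⟩ := (Nat.div_mod_unique hN0 (a := k + 1) (c := 0) (d := k / N + 1)).2
        ⟨by rw [Nat.mul_add]; omega, hN0⟩
      have h4 : ((k % N : ℕ) : ℝ) + 1 = N := by exact_mod_cast h3
      simp only [hq, h1, h2, h4]
      rw [div_self hNr.ne']
      simp
  have hΔ : ∀ i, 0 ≤ p (i + 1) - p i := fun i => sub_nonneg.2 (hp i.le_succ)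
  have hd : ∀ k, q (k + 1) - q k = 1 / N * (p (k / N + 1) - p (k / N)) := fun k => by
    rw [hstep k]; simp only [hq]; ring
  refine ⟨n * N, q, fun k => k / N, monotone_nat_of_le_succ fun k => ?_, by simp [hq, h0],
    by simp [hq, hn], fun k hk => ?_⟩
  · have := mul_nonneg (one_div_nonneg.2 hNr.le) (hΔ (k / N))
    linarith [hd k]
  · have hkn : k / N < n := (Nat.div_lt_iff_lt_mul hN0).2 hk
    refine ⟨hkn, ?_, ?_, ?_⟩
    · rw [hd k]
      have h1 : p (k / N + 1) - p (k / N) ≤ 1 := by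
        linarith [hp (Nat.zero_le (k / N)), hp (Nat.succ_le_of_lt hkn)]
      have h2 : (1:ℝ) / N ≤ c := by rw [hN]; push_cast; exact hm.le
      nlinarith [one_div_nonneg.2 hNr.le, hΔ (k / N)]
    · exact le_add_of_nonneg_right (mul_nonneg (by positivity) (hΔ _))
    · have h1 : (((k % N : ℕ) : ℝ) + 1) / N ≤ 1 := by
        rw [div_le_one hNr]
        exact_mod_cast Nat.succ_le_of_lt (Nat.mod_lt k hN0)
      rw [hstep k]
      nlinarith [hΔ (k / N)]

/-- If all the weighted sums of values selected from given sets are bounded by `K`, then so is,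
up to a small error, the weighted sum of the suprema. -/
lemma exists_upper_bounds {M : ℕ} {l s : ℕ → ℝ} (hl : ∀ k < M, 0 ≤ l k) {T : ℕ → Set ℝ}
    (hs : ∀ k < M, s k ∈ T k) {u : ℕ → ℝ → ℝ} (hu : ∀ k t, 0 ≤ u k t) {K η : ℝ} (hη : 0 < η)
    (h : ∀ τ : ℕ → ℝ, (∀ k < M, τ k ∈ T k) → ∑ k ∈ Finset.range M, l k * u k (τ k) ≤ K) :
    ∃ S : ℕ → ℝ, (∀ k, 0 ≤ S k) ∧ (∀ k < M, 0 < l k → ∀ τ ∈ T k, u k τ ≤ S k) ∧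
      ∑ k ∈ Finset.range M, l k * S k ≤ K + η * ∑ k ∈ Finset.range M, l k := by
  have hex : ∀ k, ∃ τ, (k < M → τ ∈ T k) ∧
      (k < M → 0 < l k → ∀ τ' ∈ T k, u k τ' ≤ u k τ + η) := by
    intro k
    by_cases hk : k < M ∧ 0 < l k
    · have hbd : BddAbove (u k '' T k) := by
        refine ⟨K / l k, ?_⟩
        rintro _ ⟨τ, hτ, rfl⟩
        rw [le_div_iff₀' hk.2]
        have h1 : ∀ j < M, Function.update s k τ j ∈ T j := fun j hj => by
          rcases eq_or_ne j k with rfl | hjk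
          · simpa using hτ
          · simpa [Function.update_of_ne hjk] using hs j hj
        refine le_trans ?_ (h _ h1)
        have := Finset.single_le_sum (f := fun j => l j * u j (Function.update s k τ j))
          (fun j hj => mul_nonneg (hl j (Finset.mem_range.1 hj)) (hu _ _))
          (Finset.mem_range.2 hk.1)
        simpa using this
      obtain ⟨_, ⟨τ, hτ, rfl⟩, h2⟩ := exists_lt_of_lt_csSup
        (Set.Nonempty.image (u k) ⟨s k, hs k hk.1⟩) (sub_lt_self (sSup (u k '' T k)) hη)
      exact ⟨τ, fun _ => hτ, fun _ _ τ' hτ' => by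
        linarith [le_csSup hbd (mem_image_of_mem (u k) hτ')]⟩
    · exact ⟨s k, hs k, fun h1 h2 => absurd ⟨h1, h2⟩ hk⟩
  choose τ hτ hτ' using hex
  refine ⟨fun k => u k (τ k) + η, fun k => add_nonneg (hu _ _) hη.le, fun k hk hlk => hτ' k hk hlk,
    ?_⟩
  simp only [mul_add, Finset.sum_add_distrib, ← Finset.sum_mul]
  linarith [h τ hτ, mul_comm η (∑ k ∈ Finset.range M, l k)]

/-- The points of `(q 0, q M]` are covered by the intervals of a partition. -/
lemma exists_mem_Ioc_succ {q : ℕ → ℝ} {M : ℕ} {x : ℝ} (hx : x ∈ Ioc (q 0) (q M)) :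
    ∃ k < M, x ∈ Ioc (q k) (q (k + 1)) := by
  classical
  have hex : ∃ k, x ≤ q k := ⟨M, hx.2⟩
  obtain ⟨k, hk⟩ : ∃ k, Nat.find hex = k + 1 :=
    Nat.exists_eq_succ_of_ne_zero fun h0 => absurd (h0 ▸ Nat.find_spec hex) (not_le.2 hx.1)
  have h1 : Nat.find hex ≤ M := Nat.find_min' hex hx.2
  exact ⟨k, by omega, not_le.1 (Nat.find_min hex (by omega)), hk ▸ Nat.find_spec hex⟩

/-- A function all of whose fine Riemann sums are close to `w` is, against each functional of norm
at most `1`, close in mean to a step function not depending on the functional. -/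
lemma exists_step_lintegral_le {f : ℝ → X} {w : X} {δ : ℝ → ℝ} {ε : ℝ} (hδ : IsGauge δ)
    (hε : 0 < ε) (h : ∀ (n : ℕ) (P : TP n), P.IsFine δ → ‖w - fSum P f‖ < ε) :
    ∃ σ : ℝ → X, IntegrableOn σ (Ioc 0 1) ∧ ∀ x' : X →L[ℝ] ℝ, ‖x'‖ ≤ 1 →
      ∃ Φ : ℝ → ℝ≥0∞, Measurable Φ ∧ ∫⁻ t in Ioc (0:ℝ) 1, Φ t ≤ ENNReal.ofReal (3 * ε) ∧
        ∀ t ∈ Ioc (0:ℝ) 1, ‖x' (f t) - x' (σ t)‖ₑ ≤ Φ t := by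
  obtain ⟨s₀, hs₀⟩ := RiemannSum.exists_perronFine (f := f) hδ le_rfl zero_le_one le_rfl
  obtain ⟨n, p₀, s, hp0, hpn, hps, -⟩ := hs₀.exists_seq
  set p : ℕ → ℝ := fun k => p₀ (min k n) with hp
  have hpm : Monotone p := monotone_nat_of_le_succ fun k => by
    rcases Nat.lt_or_ge k n with hk | hk
    · simpa [hp, hk.le, Nat.succ_le_of_lt hk] using (hps k hk).1
    · simp [hp, hk, hk.trans k.le_succ]
  have hfine : ∀ k < n, FreeFine δ (p k) (p (k + 1)) (s k) := fun k hk => by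
    simpa [hp, hk.le, Nat.succ_le_of_lt hk] using (hps k hk).2.2
  have hp0' : p 0 = 0 := by simp [hp, hp0]
  have hpn' : p n = 1 := by simp [hp, hpn]
  set σ : ℝ → X := fun t => ∑ i ∈ Finset.range n,
    (Ioc (p i) (p (i + 1))).indicator (fun _ => f (s i)) t with hσ
  have hσv : ∀ i < n, ∀ t ∈ Ioc (p i) (p (i + 1)), σ t = f (s i) := fun i hi t ht => by
    rw [hσ]
    refine (Finset.sum_eq_single_of_mem i (Finset.mem_range.2 hi) fun j _ hji => ?_).trans
      (indicator_of_mem ht _)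
    exact indicator_of_notMem (fun hj =>
      (disjoint_left.1 (hpm.pairwise_disjoint_on_Ioc_succ hji) hj ht).elim) _
  refine ⟨σ, ?_, fun x' hx' => ?_⟩
  · refine integrable_finsetSum _ fun i _ => ?_
    exact ((integrable_const _).indicator measurableSet_Ioc)
  have hloc : ∀ m : ℕ, ∃ φ : ℝ → ℝ≥0∞, Measurable φ ∧
      ∫⁻ t in Ioc (0:ℝ) 1, φ t ≤ ENNReal.ofReal (3 * ε) ∧
      ∀ t ∈ Ioc (0:ℝ) 1, 1 / ((m:ℝ) + 1) < δ t → ‖x' (f t) - x' (σ t)‖ₑ ≤ φ t := by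
    intro m
    obtain ⟨M, q, r, hqm, hq0, hqM, hr⟩ := exists_refinement hpm hp0' hpn'
      (Nat.one_div_pos_of_nat (α := ℝ) (n := m))
    have hs : ∀ k < M, s (r k) ∈ {t | FreeFine δ (q k) (q (k + 1)) t} := fun k hk =>
      ⟨(hfine _ (hr k hk).1).1, (Icc_subset_Icc (hr k hk).2.2.1 (hr k hk).2.2.2).trans
        (hfine _ (hr k hk).1).2⟩
    have hsum : ∀ τ : ℕ → ℝ, (∀ k < M, FreeFine δ (q k) (q (k + 1)) (τ k)) →
        ‖w - ∑ k ∈ Finset.range M, (q (k + 1) - q k) • f (τ k)‖ < ε := by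
      intro τ hτ
      have h1 := RiemannSum.concat (f := f) M fun k hk =>
        RiemannSum.single (hqm k.le_succ) (hτ k hk)
      rw [hq0, hqM] at h1
      obtain ⟨N, P, hP, hPs⟩ := h1.exists_isFine
      exact hPs ▸ h N P hP
    have hl : ∀ k, 0 ≤ q (k + 1) - q k := fun k => sub_nonneg.2 (hqm k.le_succ)
    obtain ⟨S, hS0, hS, hSs⟩ := exists_upper_bounds (M := M) (l := fun k => q (k + 1) - q k)
      (s := fun k => s (r k)) (u := fun k t => |x' (f t) - x' (f (s (r k)))|) (K := 2 * ε)
      (fun k _ => hl k) hs (fun _ _ => abs_nonneg _) hε fun τ hτ => by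
        classical
        set a : ℕ → ℝ := fun k => if x' (f (s (r k))) ≤ x' (f (τ k)) then τ k else s (r k) with ha
        set b : ℕ → ℝ := fun k => if x' (f (s (r k))) ≤ x' (f (τ k)) then s (r k) else τ k with hb
        have h1 := hsum a fun k hk => by
          simp only [ha]; split_ifs
          exacts [hτ k hk, hs k hk]
        have h2 := hsum b fun k hk => by
          simp only [hb]; split_ifs
          exacts [hs k hk, hτ k hk]
        have h3 : ∑ k ∈ Finset.range M, (q (k + 1) - q k) * |x' (f (τ k)) - x' (f (s (r k)))| =
            x' (∑ k ∈ Finset.range M, (q (k + 1) - q k) • f (a k) -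
              ∑ k ∈ Finset.range M, (q (k + 1) - q k) • f (b k)) := by
          rw [← Finset.sum_sub_distrib, map_sum]
          refine Finset.sum_congr rfl fun k _ => ?_
          simp only [ha, hb, ← smul_sub, map_smul, smul_eq_mul, map_sub]
          split_ifs with h4
          · rw [abs_of_nonneg (sub_nonneg.2 h4)]
          · rw [abs_of_neg (sub_neg.2 (not_le.1 h4)), neg_sub]
        rw [h3]
        refine (le_abs_self _).trans ((x'.le_of_opNorm_le hx' _).trans ?_)
        rw [one_mul, ← sub_sub_sub_cancel_left _ _ w]
        exact (norm_sub_le _ _).trans (by linarith)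
    refine ⟨fun t => ∑ k ∈ Finset.range M,
      (Ioc (q k) (q (k + 1))).indicator (fun _ => ENNReal.ofReal (S k)) t,
      Finset.measurable_sum _ fun k _ => measurable_const.indicator measurableSet_Ioc, ?_, ?_⟩
    · rw [Finset.sum_range_sub (fun k => q k), hq0, hqM] at hSs
      calc ∫⁻ t in Ioc (0:ℝ) 1, _ ≤ ∫⁻ t, ∑ k ∈ Finset.range M,
            (Ioc (q k) (q (k + 1))).indicator (fun _ => ENNReal.ofReal (S k)) t :=
            setLIntegral_le_lintegral _ _
        _ = ∑ k ∈ Finset.range M, ENNReal.ofReal ((q (k + 1) - q k) * S k) := by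
            rw [lintegral_finsetSum _ fun k _ => measurable_const.indicator measurableSet_Ioc]
            refine Finset.sum_congr rfl fun k _ => ?_
            rw [lintegral_indicator_const measurableSet_Ioc, Real.volume_Ioc, mul_comm,
              ENNReal.ofReal_mul (hl k)]
        _ ≤ ENNReal.ofReal (3 * ε) := by
            rw [← ENNReal.ofReal_sum_of_nonneg fun k _ => mul_nonneg (hl k) (hS0 k)]
            exact ENNReal.ofReal_le_ofReal (by linarith)
    · intro t ht htδ
      obtain ⟨k, hk, htk⟩ := exists_mem_Ioc_succ (q := q) (M := M) (by rwa [hq0, hqM])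
      have hff : FreeFine δ (q k) (q (k + 1)) t := by
        refine ⟨Ioc_subset_Icc_self ht, fun y hy => ?_⟩
        have := (hr k hk).2.1
        exact ⟨by linarith [hy.1, htk.2], by linarith [hy.2, htk.1]⟩
      have h1 := hS k hk (sub_pos.2 (htk.1.trans_le htk.2)) t hff
      have h2 : σ t = f (s (r k)) := hσv _ (hr k hk).1 t
        ⟨(hr k hk).2.2.1.trans_lt htk.1, htk.2.trans (hr k hk).2.2.2⟩
      calc ‖x' (f t) - x' (σ t)‖ₑ ≤ ENNReal.ofReal (S k) := by
            rw [h2, Real.enorm_eq_ofReal_abs]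
            exact ENNReal.ofReal_le_ofReal h1
        _ = (Ioc (q k) (q (k + 1))).indicator (fun _ => ENNReal.ofReal (S k)) t :=
            (indicator_of_mem htk fun _ => ENNReal.ofReal (S k)).symm
        _ ≤ _ := Finset.single_le_sum (f := fun k => (Ioc (q k) (q (k + 1))).indicator
              (fun _ => ENNReal.ofReal (S k)) t) (fun _ _ => zero_le) (Finset.mem_range.2 hk)
  choose φ hφm hφi hφ using hloc
  refine ⟨fun t => liminf (fun m => φ m t) atTop, Measurable.liminf hφm, ?_, fun t ht => ?_⟩
  · refine (lintegral_liminf_le hφm).trans ?_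
    exact (liminf_le_liminf (Eventually.of_forall hφi)).trans (by simp)
  · refine le_liminf_of_le (by isBoundedDefault) ?_
    filter_upwards [tendsto_one_div_add_atTop_nhds_zero_nat.eventually
      (gt_mem_nhds (hδ t (Ioc_subset_Icc_self ht)))] with m hm
    exact hφ m t ht hm

lemma FBirkhoffIntegrable.fHMeasIntegrable {f : ℝ → X} (hf : FBirkhoffIntegrable f) :
    FHMeasIntegrable f := by
  obtain ⟨w, hw⟩ := hf
  refine ⟨w, fun ε hε => ?_⟩
  obtain ⟨δ, hδ, hδm, h⟩ := hw ε hε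
  exact ⟨δ, hδ, hδm, fun n P _ hP => h n P hP⟩

lemma FBirkhoffIntegrable.fMcShaneIntegrable {f : ℝ → X} (hf : FBirkhoffIntegrable f) :
    FMcShaneIntegrable f := by
  obtain ⟨w, hw⟩ := hf
  refine ⟨w, fun ε hε => ?_⟩
  obtain ⟨δ, hδ, -, h⟩ := hw ε hε
  exact ⟨δ, hδ, h⟩

/-- McShane integrable functions are Pettis integrable. -/
theorem FMcShaneIntegrable.fPettisIntegrable [CompleteSpace X] {f : ℝ → X}
    (hf : FMcShaneIntegrable f) : FPettisIntegrable f := by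
  obtain ⟨w, hw⟩ := hf
  set μ : Measure ℝ := volume.restrict (Ioc (0:ℝ) 1) with hμ
  have hμ' : volume.restrict (Icc (0:ℝ) 1) = μ := restrict_Ioc_eq_restrict_Icc.symm
  have hstep : ∀ n : ℕ, ∃ σ : ℝ → X, Integrable σ μ ∧ ∀ x' : X →L[ℝ] ℝ, ‖x'‖ ≤ 1 →
      ∃ Φ : ℝ → ℝ≥0∞, Measurable Φ ∧ ∫⁻ t, Φ t ∂μ ≤ ENNReal.ofReal ((1 / 2) ^ n) ∧
        ∀ t ∈ Ioc (0:ℝ) 1, ‖x' (f t) - x' (σ t)‖ₑ ≤ Φ t := by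
    intro n
    have hε : (0:ℝ) < (1 / 2) ^ n / 3 := by positivity
    obtain ⟨δ, hδ, h⟩ := hw _ hε
    simpa only [mul_div_cancel₀ ((1 / 2 : ℝ) ^ n) three_ne_zero, IntegrableOn] using
      exists_step_lintegral_le hδ hε h
  choose σ hσi hσ using hstep
  have hσx : ∀ (x' : X →L[ℝ] ℝ) n, Integrable (fun t => x' (σ n t)) μ := fun x' n =>
    x'.integrable_comp (hσi n)
  have hlint : ∀ x' : X →L[ℝ] ℝ, ‖x'‖ ≤ 1 → ∀ n,
      ∫⁻ t, ‖x' (f t) - x' (σ n t)‖ₑ ∂μ ≤ ENNReal.ofReal ((1 / 2) ^ n) := by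
    intro x' hx' n
    obtain ⟨Φ, -, hΦi, hΦ⟩ := hσ n x' hx'
    exact (setLIntegral_mono' measurableSet_Ioc hΦ).trans hΦi
  have hsummable : ∑' n : ℕ, ENNReal.ofReal ((1 / 2 : ℝ) ^ n) ≠ ∞ := by
    rw [← ENNReal.ofReal_tsum_of_nonneg (fun n => by positivity) summable_geometric_two]
    exact ENNReal.ofReal_ne_top
  have hmeas : ∀ x' : X →L[ℝ] ℝ, ‖x'‖ ≤ 1 → AEStronglyMeasurable (fun t => x' (f t)) μ := by
    intro x' hx'
    choose Φ hΦm hΦi hΦ using fun n => hσ n x' hx'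
    refine aestronglyMeasurable_of_tendsto_ae atTop (fun n => (hσx x' n).aestronglyMeasurable) ?_
    have hfin : ∫⁻ t, ∑' n, Φ n t ∂μ ≠ ∞ := by
      rw [lintegral_tsum fun n => (hΦm n).aemeasurable]
      exact ne_top_of_le_ne_top hsummable (ENNReal.tsum_le_tsum hΦi)
    filter_upwards [ae_lt_top (Measurable.tsum hΦm) hfin,
      ae_restrict_mem measurableSet_Ioc] with t ht htm
    rw [tendsto_iff_edist_tendsto_0]
    refine tendsto_of_tendsto_of_tendsto_of_le_of_le tendsto_const_nhds
      (ENNReal.tendsto_atTop_zero_of_tsum_ne_top ht.ne) (fun _ => zero_le) fun n => ?_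
    rw [edist_comm, edist_eq_enorm_sub]
    exact hΦ n t htm
  have hint : ∀ x' : X →L[ℝ] ℝ, ‖x'‖ ≤ 1 → Integrable (fun t => x' (f t)) μ := by
    intro x' hx'
    have h1 : Integrable (fun t => x' (f t) - x' (σ 0 t)) μ :=
      ⟨(hmeas x' hx').sub (hσx x' 0).aestronglyMeasurable,
        (hlint x' hx' 0).trans_lt ENNReal.ofReal_lt_top⟩
    exact (h1.add (hσx x' 0)).congr (Eventually.of_forall fun t => sub_add_cancel _ _)
  have hscale : ∀ x' : X →L[ℝ] ℝ, ∃ c : ℝ, ∃ y' : X →L[ℝ] ℝ, ‖y'‖ ≤ 1 ∧ x' = c • y' := by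
    intro x'
    have hc : 0 < ‖x'‖ + 1 := by positivity
    refine ⟨‖x'‖ + 1, (‖x'‖ + 1)⁻¹ • x', ?_, (smul_inv_smul₀ hc.ne' x').symm⟩
    rw [norm_smul, norm_inv, Real.norm_of_nonneg hc.le, inv_mul_le_one₀ hc]
    linarith
  refine ⟨fun x' => ?_, fun E hE _ => ?_⟩
  · obtain ⟨c, y', hy', rfl⟩ := hscale x'
    rw [IntegrableOn, hμ']
    exact (hint y' hy').const_mul c
  have hρ : volume.restrict E ≤ μ := hμ' ▸ Measure.restrict_mono hE le_rfl
  have happrox : ∀ x' : X →L[ℝ] ℝ, ‖x'‖ ≤ 1 → ∀ n,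
      |(∫ t in E, x' (f t)) - x' (∫ t in E, σ n t)| ≤ (1 / 2) ^ n := by
    intro x' hx' n
    rw [← x'.integral_comp_comm ((hσi n).mono_measure hρ),
      ← integral_sub ((hint x' hx').mono_measure hρ) ((hσx x' n).mono_measure hρ),
      ← ENNReal.ofReal_le_ofReal_iff (by positivity), ← Real.enorm_eq_ofReal_abs]
    exact (enorm_integral_le_lintegral_enorm _).trans
      ((lintegral_mono' hρ le_rfl).trans (hlint x' hx' n))
  have hcauchy : CauchySeq fun n => ∫ t in E, σ n t := by
    refine cauchySeq_of_le_geometric (1 / 2) 2 (by norm_num) fun n => ?_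
    obtain ⟨g, hg, hgv⟩ := exists_dual_vector'' ℝ ((∫ t in E, σ n t) - ∫ t in E, σ (n + 1) t)
    have h1 := abs_le.1 (happrox g hg n)
    have h2 := abs_le.1 (happrox g hg (n + 1))
    have h3 : ((1:ℝ) / 2) ^ (n + 1) ≤ (1 / 2) ^ n :=
      pow_le_pow_of_le_one (by norm_num) (by norm_num) n.le_succ
    rw [dist_eq_norm]
    rw [map_sub] at hgv
    have h4 : g (∫ t in E, σ n t) - g (∫ t in E, σ (n + 1) t) =
      ‖(∫ t in E, σ n t) - ∫ t in E, σ (n + 1) t‖ := by simpa using hgv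
    linarith [h1.1, h2.2]
  obtain ⟨ν, hν⟩ := cauchySeq_tendsto_of_complete hcauchy
  refine ⟨ν, fun x' => ?_⟩
  have hunit : ∀ x' : X →L[ℝ] ℝ, ‖x'‖ ≤ 1 → x' ν = ∫ t in E, x' (f t) := by
    intro x' hx'
    refine tendsto_nhds_unique ((x'.continuous.tendsto ν).comp hν)
      (tendsto_iff_dist_tendsto_zero.2 ?_)
    refine squeeze_zero (fun _ => dist_nonneg) (fun n => ?_)
      (tendsto_pow_atTop_nhds_zero_of_lt_one (r := (1 / 2 : ℝ)) (by norm_num) (by norm_num))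
    rw [dist_comm, Real.dist_eq]
    exact happrox x' hx' n
  obtain ⟨c, y', hy', rfl⟩ := hscale x'
  simp only [smul_apply, smul_eq_mul, integral_const_mul, hunit y' hy']

/-- Theorem `t11` of the paper. A Banach space valued function on `[0,1]`
is Birkhoff (`ℳ`-) integrable if and only if it is `ℋ`-integrable and Pettis integrable. -/
theorem birkhoff_iff_HMeas_and_pettis
    {X : Type*} [NormedAddCommGroup X] [NormedSpace ℝ X] [CompleteSpace X] (f : ℝ → X) :
    FBirkhoffIntegrable f ↔ (FHMeasIntegrable f ∧ FPettisIntegrable f) :=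
  ⟨fun h => ⟨h.fHMeasIntegrable, h.fMcShaneIntegrable.fPettisIntegrable⟩,
    fun h => birkhoffIntegrable_of_hMeas_of_pettis h.1 h.2⟩

end GaugePaper
end

section
/- Let X be a Banach space and Φ : 𝓘 → cwk(X) an interval multimeasure on the family 𝓘 of closed subintervals of [0,1] such that for every x* ∈ X* the variational measure of the scalar interval measure σ(x*,Φ(·)) is absolutely continuous with respect to Lebesgue measure, and such that σ(x*,Φ(I)) ≥ 0 for every x* ∈ X* and every I ∈ 𝓘. Then Φ extends to a multimeasure M : 𝓛 → cwk(X) on the Lebesgue σ-algebra 𝓛 with M(A) = {0} whenever λ(A) = 0. -/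
open Set Metric MeasureTheory Pointwise
open scoped ENNReal NNReal

namespace GaugePaper

variable (X : Type*) [NormedAddCommGroup X] [NormedSpace ℝ X]

variable {X}

/-! ### Scalar interval functions and Stieltjes measures -/

lemma sum_le_scVar {Ψ : ℝ → ℝ → ℝ} {δ : ℝ → ℝ} {E : Set ℝ} {ι : Type*} [Fintype ι]
    (a b t : ι → ℝ) (hsub : ∀ i, Icc (a i) (b i) ⊆ Icc (0 : ℝ) 1)
    (hno : ∀ i j, i ≠ j → (Icc (a i) (b i) ∩ Icc (a j) (b j)).Subsingleton)
    (ht : ∀ i, t i ∈ Icc (a i) (b i))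
    (hfine : ∀ i, Icc (a i) (b i) ⊆ Ioo (t i - δ (t i)) (t i + δ (t i)))
    (htE : ∀ i, t i ∈ E) :
    ∑ i, ENNReal.ofReal |Ψ (a i) (b i)| ≤ scVar Ψ δ E := by
  let e := Fintype.equivFin ι
  let P : PTP (Fintype.card ι) :=
    { a := a ∘ e.symm
      b := b ∘ e.symm
      tag := t ∘ e.symm
      le := fun i => (ht _).1.trans (ht _).2
      sub := fun i => hsub _
      nonoverlap := fun i j hij => hno _ _ (e.symm.injective.ne hij)
      perron := fun i => ht _ }
  calc ∑ i, ENNReal.ofReal |Ψ (a i) (b i)|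
      = ∑ i, ENNReal.ofReal |Ψ (P.a i) (P.b i)| :=
        (Equiv.sum_comp e.symm fun i => ENNReal.ofReal |Ψ (a i) (b i)|).symm
    _ ≤ scVar Ψ δ E :=
        le_iSup_of_le _ (le_iSup_of_le P (le_iSup_of_le
          ⟨fun i => hfine (e.symm i), fun i => htE (e.symm i)⟩ le_rfl))

lemma exists_gauge_scVar_lt {Ψ : ℝ → ℝ → ℝ} {E : Set ℝ} (h : scVarMeasure Ψ E = 0)
    {ε : ℝ≥0∞} (hε : 0 < ε) : ∃ δ, IsGauge δ ∧ scVar Ψ δ E < ε := by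
  have : scVarMeasure Ψ E < ε := h ▸ hε
  simpa [scVarMeasure, iInf_lt_iff] using this

lemma exists_mem_Icc_div {N : ℕ} (hN : 0 < N) {t : ℝ} (ht : t ∈ Icc (0 : ℝ) 1) :
    ∃ i : Fin N, t ∈ Icc ((i : ℝ) / N) (((i : ℝ) + 1) / N) := by
  have hN' : (0 : ℝ) < N := by exact_mod_cast hN
  have h0 : 0 ≤ t * N := mul_nonneg ht.1 hN'.le
  rcases lt_or_ge t 1 with h1 | h1
  · refine ⟨⟨⌊t * N⌋₊, (Nat.floor_lt h0).2 (by nlinarith)⟩, ?_, ?_⟩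
    · rw [div_le_iff₀ hN']
      exact Nat.floor_le h0
    · rw [le_div_iff₀ hN']
      exact (Nat.lt_floor_add_one _).le
  · obtain rfl : t = 1 := le_antisymm ht.2 h1
    obtain ⟨m, rfl⟩ := Nat.exists_eq_succ_of_ne_zero hN.ne'
    refine ⟨Fin.last m, ?_, ?_⟩
    · rw [div_le_iff₀ hN']
      simp
    · rw [le_div_iff₀ hN']
      simp

lemma Icc_div_inter_subsingleton {N : ℕ} (i j : ℕ) (hij : i ≠ j) :
    (Icc ((i : ℝ) / N) (((i : ℝ) + 1) / N) ∩
      Icc ((j : ℝ) / N) (((j : ℝ) + 1) / N)).Subsingleton := by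
  wlog h : i < j generalizing i j
  · rw [inter_comm]
    exact this j i hij.symm (by omega)
  have h1 : ((i : ℝ) + 1) / N ≤ (j : ℝ) / N := by
    gcongr
    exact_mod_cast h
  rintro x ⟨hx1, hx2⟩ y ⟨hy1, hy2⟩
  linarith [hx1.2, hx2.1, hy1.2, hy2.1]

lemma measure_eq_zero_of_scVarMeasure_eq_zero {Ψ : ℝ → ℝ → ℝ} (f : StieltjesFunction ℝ)
    (hf : Continuous f) (hΨ : ∀ a b : ℝ, 0 ≤ a → a ≤ b → b ≤ 1 → Ψ a b = f b - f a)
    {E : Set ℝ} (hE : E ⊆ Icc (0 : ℝ) 1) (h : scVarMeasure Ψ E = 0) : f.measure E = 0 := by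
  refine nonpos_iff_eq_zero.1 (le_of_forall_gt fun ε hε => ?_)
  obtain ⟨δ, hδ, hlt⟩ := exists_gauge_scVar_lt h hε
  refine lt_of_le_of_lt ?_ hlt
  let s : ℕ → Set ℝ := fun n => {t ∈ E | 1 / ((n : ℝ) + 1) < δ t}
  have hs : Monotone s := fun m n hmn t ht =>
    ⟨ht.1, lt_of_le_of_lt (Nat.one_div_le_one_div hmn) ht.2⟩
  have hsE : E = ⋃ n, s n := by
    refine Subset.antisymm (fun t ht => ?_) (iUnion_subset fun n t ht => ht.1)
    obtain ⟨n, hn⟩ := exists_nat_one_div_lt (hδ t (hE ht))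
    exact mem_iUnion.2 ⟨n, ht, hn⟩
  rw [hsE, hs.directed_le.measure_iUnion, ← hsE]
  refine iSup_le fun n => ?_
  have hpos : (0 : ℝ) < ((n + 1 : ℕ) : ℝ) := by positivity
  let l : ℕ → ℝ := fun i => (i : ℝ) / ((n + 1 : ℕ) : ℝ)
  let r : ℕ → ℝ := fun i => ((i : ℝ) + 1) / ((n + 1 : ℕ) : ℝ)
  have hr : ∀ i, r i = l i + 1 / ((n : ℝ) + 1) := fun i => by
    simp only [r, l]
    push_cast
    ring
  classical
  let ι := {i : Fin (n + 1) // (s n ∩ Icc (l i) (r i)).Nonempty}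
  choose t ht using fun i : ι => i.2
  have hl0 : ∀ i : ι, 0 ≤ l i.1 := fun i => by positivity
  have hr1 : ∀ i : ι, r i.1 ≤ 1 := fun i => by
    simp only [r]
    rw [div_le_one hpos]
    exact_mod_cast i.1.2
  have hle : ∀ i : ι, l i.1 ≤ r i.1 := fun i => (ht i).2.1.trans (ht i).2.2
  calc f.measure (s n) ≤ f.measure (⋃ i : ι, Icc (l i.1) (r i.1)) := by
        refine measure_mono fun x hx => ?_
        obtain ⟨i, hi⟩ := exists_mem_Icc_div n.succ_pos (hE hx.1)
        exact mem_iUnion.2 ⟨⟨i, x, hx, hi⟩, hi⟩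
    _ ≤ ∑ i : ι, f.measure (Icc (l i.1) (r i.1)) := measure_iUnion_fintype_le _ _
    _ = ∑ i : ι, ENNReal.ofReal |Ψ (l i.1) (r i.1)| := by
        refine Finset.sum_congr rfl fun i _ => ?_
        rw [f.measure_Icc, hf.continuousAt.continuousWithinAt.leftLim_eq,
          hΨ _ _ (hl0 i) (hle i) (hr1 i), abs_of_nonneg (sub_nonneg.2 (f.mono (hle i)))]
    _ ≤ scVar Ψ δ E := by
        refine sum_le_scVar _ _ t (fun i => Icc_subset_Icc (hl0 i) (hr1 i)) (fun i j hij => ?_)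
          (fun i => (ht i).2) (fun i x hx => ?_) fun i => (ht i).1.1
        · exact Icc_div_inter_subsingleton _ _ fun h => hij (Subtype.ext (Fin.ext h))
        · have h1 := (ht i).1.2
          have h2 := (ht i).2
          have h3 := hr i.1
          constructor <;> linarith [hx.1, hx.2, h2.1, h2.2]

/-- The distribution function of a nonnegative additive interval function on `[0,1]` whose
variational measure vanishes on singletons is continuous. -/
lemma exists_stieltjesFunction {Ψ : ℝ → ℝ → ℝ}
    (hadd : ∀ a b c : ℝ, 0 ≤ a → a ≤ b → b ≤ c → c ≤ 1 → Ψ a c = Ψ a b + Ψ b c)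
    (hpos : ∀ a b : ℝ, 0 ≤ a → a ≤ b → b ≤ 1 → 0 ≤ Ψ a b)
    (hvar : ∀ t ∈ Icc (0 : ℝ) 1, scVarMeasure Ψ {t} = 0) :
    ∃ f : StieltjesFunction ℝ, Continuous f ∧
      ∀ t, f t = Ψ 0 (projIcc (0 : ℝ) 1 zero_le_one t) := by
  let F : Icc (0 : ℝ) 1 → ℝ := fun t => Ψ 0 t
  have hF : ∀ s t : Icc (0 : ℝ) 1, s ≤ t → F t - F s = Ψ s t := fun s t hst => by
    have := hadd 0 s t le_rfl s.2.1 hst t.2.2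
    simp only [F]
    linarith
  have hmono : Monotone F := fun s t hst =>
    sub_nonneg.1 ((hF s t hst).symm ▸ hpos _ _ s.2.1 hst t.2.2)
  have hcont : Continuous F := by
    refine continuous_iff_continuousAt.2 fun t => Metric.continuousAt_iff.2 fun ε hε => ?_
    obtain ⟨δ, hδ, hlt⟩ := exists_gauge_scVar_lt (hvar t t.2) (ENNReal.ofReal_pos.2 hε)
    have key : ∀ a b : Icc (0 : ℝ) 1, a ≤ b → (t : ℝ) ∈ Icc (a : ℝ) b →
        Icc (a : ℝ) b ⊆ Ioo ((t : ℝ) - δ t) (t + δ t) → |F b - F a| < ε := by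
      intro a b hab htab hfine
      have := sum_le_scVar (Ψ := Ψ) (δ := δ) (E := {(t : ℝ)}) (ι := Unit) (fun _ => a) (fun _ => b)
        (fun _ => t) (fun _ => Icc_subset_Icc a.2.1 b.2.2) (fun i j hij => (hij rfl).elim)
        (fun _ => htab) (fun _ => hfine) (fun _ => rfl)
      rw [hF a b hab]
      refine (ENNReal.ofReal_lt_ofReal_iff hε).1 (lt_of_le_of_lt ?_ hlt)
      simpa using this
    refine ⟨δ t, hδ t t.2, fun {s} hs => ?_⟩
    rw [Subtype.dist_eq, Real.dist_eq, abs_lt] at hs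
    rw [Real.dist_eq]
    rcases le_total s t with h | h
    · rw [abs_sub_comm]
      exact key s t h ⟨h, le_rfl⟩ fun x hx => ⟨by linarith [hx.1], by linarith [hx.2, hδ t t.2]⟩
    · exact key t s h ⟨le_rfl, h⟩ fun x hx => ⟨by linarith [hx.1, hδ t t.2], by linarith [hx.2]⟩
  have hc : Continuous fun t => F (projIcc (0 : ℝ) 1 zero_le_one t) :=
    hcont.comp continuous_projIcc
  exact ⟨⟨_, hmono.comp (monotone_projIcc _), fun x => hc.continuousWithinAt⟩, hc, fun _ => rfl⟩

lemma stieltjes_measure_le_of_monotone_sub {f g : StieltjesFunction ℝ}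
    (h : Monotone fun t => g t - f t) : f.measure ≤ g.measure := by
  let d : StieltjesFunction ℝ :=
    ⟨_, h, fun x => (g.right_continuous x).sub (f.right_continuous x)⟩
  have hg : g = f + d := by
    ext t
    simp [d]
  rw [hg, StieltjesFunction.measure_add]
  exact Measure.le_add_right le_rfl

/-! ### Support functions of convex weakly compact sets -/

lemma continuous_dual_weakSpace (x' : X →L[ℝ] ℝ) :
    Continuous fun w : WeakSpace ℝ X => x' ((toWeakSpace ℝ X).symm w) :=
  WeakBilin.eval_continuous (topDualPairing ℝ X).flip x'

lemma IsCWK.isCompact_image {K : Set X} (hK : IsCWK X K) (x' : X →L[ℝ] ℝ) :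
    IsCompact (x' '' K) := by
  have := hK.2.2.image (continuous_dual_weakSpace x')
  simpa [image_image] using this

lemma IsCWK.le_suppFn {K : Set X} (hK : IsCWK X K) (x' : X →L[ℝ] ℝ) {x : X} (hx : x ∈ K) :
    x' x ≤ suppFn x' K :=
  le_csSup (hK.isCompact_image x').bddAbove (mem_image_of_mem _ hx)

lemma IsCWK.suppFn_add_set {A B : Set X} (hA : IsCWK X A) (hB : IsCWK X B) (x' : X →L[ℝ] ℝ) :
    suppFn x' (A + B) = suppFn x' A + suppFn x' B := by
  rw [suppFn, image_add]
  exact csSup_add (hA.1.image _) (hA.isCompact_image x').bddAbove (hB.1.image _)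
    (hB.isCompact_image x').bddAbove

lemma IsCWK.suppFn_add_le {K : Set X} (hK : IsCWK X K) (x' y' : X →L[ℝ] ℝ) :
    suppFn (x' + y') K ≤ suppFn x' K + suppFn y' K := by
  refine csSup_le (hK.1.image _) ?_
  rintro _ ⟨x, hx, rfl⟩
  exact add_le_add (hK.le_suppFn x' hx) (hK.le_suppFn y' hx)

lemma suppFn_smul {c : ℝ} (hc : 0 ≤ c) (x' : X →L[ℝ] ℝ) (K : Set X) :
    suppFn (c • x') K = c * suppFn x' K := by
  have : (c • x') '' K = c • (x' '' K) := by
    rw [← image_smul, image_image]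
    rfl
  rw [suppFn, this, Real.sSup_smul_of_nonneg hc, smul_eq_mul, suppFn]

/-- A linear functional on the dual dominated by the support function of a convex weakly compact
set is the evaluation at a point of that set. -/
lemma IsCWK.exists_eq_eval {K : Set X} (hK : IsCWK X K) (l : (X →L[ℝ] ℝ) →ₗ[ℝ] ℝ)
    (hl : ∀ x', l x' ≤ suppFn x' K) : ∃ x ∈ K, ∀ x', l x' = x' x := by
  have hfin : ∀ u : Finset (X →L[ℝ] ℝ), (toWeakSpace ℝ X '' K ∩
      ⋂ x' ∈ u, {w | x' ((toWeakSpace ℝ X).symm w) = l x'}).Nonempty := by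
    intro u
    classical
    let T : X →ₗ[ℝ] (u → ℝ) := LinearMap.pi fun i => (i.1 : X →L[ℝ] ℝ).toLinearMap
    have hcomp : IsCompact (T '' K) := by
      have hc : Continuous fun w : WeakSpace ℝ X => T ((toWeakSpace ℝ X).symm w) :=
        continuous_pi fun i => continuous_dual_weakSpace i.1
      have := hK.2.2.image hc
      simpa [image_image] using this
    have hmem : (fun i : u => l i.1) ∈ T '' K := by
      by_contra hnot
      obtain ⟨φ, c, hφ, hc⟩ := geometric_hahn_banach_closed_point
        (hK.2.1.linear_image T) hcomp.isClosed hnot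
      let y' : X →L[ℝ] ℝ := ∑ i : u, φ (fun j => if i = j then 1 else 0) • i.1
      have h1 : ∀ v : u → ℝ, φ v = ∑ i : u, φ (fun j => if i = j then 1 else 0) * v i := by
        intro v
        rw [← ContinuousLinearMap.coe_coe, LinearMap.pi_apply_eq_sum_univ]
        simp [mul_comm]
      have h2 : φ (fun i : u => l i.1) = l y' := by
        rw [h1]
        simp [y', map_sum]
      have h3 : suppFn y' K ≤ c := by
        refine csSup_le (hK.1.image _) ?_
        rintro _ ⟨x, hx, rfl⟩
        refine le_trans (le_of_eq ?_) (hφ _ (mem_image_of_mem T hx)).le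
        rw [h1]
        simp [y', T]
      linarith [hl y']
    obtain ⟨x, hx, hxl⟩ := hmem
    exact ⟨toWeakSpace ℝ X x, mem_image_of_mem _ hx,
      mem_iInter₂.2 fun x' hx' => congrFun hxl ⟨x', hx'⟩⟩
  obtain ⟨w, ⟨x, hx, rfl⟩, hw⟩ := hK.2.2.inter_iInter_nonempty _
    (fun x' => isClosed_eq (continuous_dual_weakSpace x') continuous_const) hfin
  refine ⟨x, hx, fun x' => ?_⟩
  have := mem_iInter.1 hw x'
  simpa using this.symm

lemma IsCWK.eq_setOf_le_suppFn {K : Set X} (hK : IsCWK X K) :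
    {x | ∀ x' : X →L[ℝ] ℝ, x' x ≤ suppFn x' K} = K := by
  refine Subset.antisymm (fun x hx => ?_) fun x hx x' => hK.le_suppFn x' hx
  obtain ⟨y, hy, hxy⟩ := hK.exists_eq_eval
    ((ContinuousLinearMap.apply ℝ ℝ x).toLinearMap) (fun x' => hx x')
  have : x = y := (SeparatingDual.eq_iff_forall_dual_eq (R := ℝ)).2 fun g => hxy g
  exact this ▸ hy

/-- A nonnegative sublinear functional on the dual dominated by the support function of a convex
weakly compact set is itself the support function of a convex weakly compact set. -/
lemma IsCWK.of_sublinear_le {K : Set X} (hK : IsCWK X K) (p : (X →L[ℝ] ℝ) → ℝ)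
    (hp0 : ∀ x', 0 ≤ p x') (hpK : ∀ x', p x' ≤ suppFn x' K)
    (hadd : ∀ x' y', p (x' + y') ≤ p x' + p y')
    (hsmul : ∀ c : ℝ, 0 ≤ c → ∀ x', p (c • x') = c * p x') :
    IsCWK X {x | ∀ x' : X →L[ℝ] ℝ, x' x ≤ p x'} ∧
      ∀ x', suppFn x' {x | ∀ x' : X →L[ℝ] ℝ, x' x ≤ p x'} = p x' := by
  set C := {x | ∀ x' : X →L[ℝ] ℝ, x' x ≤ p x'} with hC
  have h0 : (0 : X) ∈ C := fun x' => by simpa using hp0 x'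
  have hCK : C ⊆ K := fun x hx => by
    rw [← hK.eq_setOf_le_suppFn]
    exact fun x' => (hx x').trans (hpK x')
  refine ⟨⟨⟨0, h0⟩, ?_, ?_⟩, fun x' => ?_⟩
  · intro x hx y hy a b ha hb hab x'
    have h1 := mul_le_mul_of_nonneg_left (hx x') ha
    have h2 := mul_le_mul_of_nonneg_left (hy x') hb
    have h3 : a * p x' + b * p x' = p x' := by rw [← add_mul, hab, one_mul]
    simp only [map_add, map_smul, smul_eq_mul]
    linarith
  · have hclosed : IsClosed (⋂ x' : X →L[ℝ] ℝ, {w : WeakSpace ℝ X |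
        x' ((toWeakSpace ℝ X).symm w) ≤ p x'}) :=
      isClosed_iInter fun x' => isClosed_le (continuous_dual_weakSpace x') continuous_const
    convert hK.2.2.inter_right hclosed using 1
    ext w
    constructor
    · rintro ⟨x, hx, rfl⟩
      exact ⟨mem_image_of_mem _ (hCK hx), mem_iInter.2 fun x' => by simpa using hx x'⟩
    · rintro ⟨⟨x, -, rfl⟩, hw⟩
      exact mem_image_of_mem _ fun x' => by simpa using mem_iInter.1 hw x'
  · refine le_antisymm (csSup_le ⟨_, mem_image_of_mem _ h0⟩ ?_) ?_
    · rintro _ ⟨x, hx, rfl⟩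
      exact hx x'
    · have hbdd : BddAbove (x' '' C) := ⟨p x', by
        rintro _ ⟨x, hx, rfl⟩
        exact hx x'⟩
      rcases eq_or_ne x' 0 with rfl | hne
      · have : p 0 = 0 := by simpa using hsmul 0 le_rfl 0
        rw [this]
        exact le_csSup hbdd ⟨0, h0, by simp⟩
      · obtain ⟨g, hg, hgp⟩ := exists_extension_of_le_sublinear
          (LinearPMap.mkSpanSingleton (K := ℝ) x' (p x') hne) p
          (fun c hc => hsmul c hc.le) hadd (by
            rintro ⟨y', hy'⟩
            obtain ⟨c, rfl⟩ := Submodule.mem_span_singleton.1 hy'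
            rw [LinearPMap.mkSpanSingleton'_apply]
            rcases le_total 0 c with hc | hc
            · exact (hsmul c hc x').ge
            · exact (mul_nonpos_of_nonpos_of_nonneg hc (hp0 x')).trans (hp0 _))
        obtain ⟨x, -, hx⟩ := hK.exists_eq_eval g fun y' => (hgp y').trans (hpK y')
        have hxC : x ∈ C := fun y' => hx y' ▸ hgp y'
        have hxp : x' x = p x' := by
          rw [← hx x']
          have := hg ⟨x', Submodule.mem_span_singleton_self x'⟩
          rw [this]
          exact LinearPMap.mkSpanSingleton'_apply_self _ _ _ _
        exact hxp ▸ le_csSup hbdd (mem_image_of_mem _ hxC)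

/-- Proposition 3.1 of the paper. An interval multimeasure
`Φ : 𝓘 → cwk(X)` whose scalar variational measures `V_{σ(x*,Φ)}` are `λ`-continuous and whose
values have nonnegative support functions extends to a `λ`-continuous multimeasure on the
Lebesgue measurable subsets of `[0,1]`. -/
theorem interval_multimeasure_extension
    {X : Type*} [NormedAddCommGroup X] [NormedSpace ℝ X] [CompleteSpace X]
    (Φ : ℝ → ℝ → Set X)
    (hcwk : ∀ a b : ℝ, 0 ≤ a → a ≤ b → b ≤ 1 → IsCWK X (Φ a b))
    (hadd : AdditiveIntervalMF Φ)
    (hvar : ∀ x' : X →L[ℝ] ℝ, ∀ E ⊆ Icc (0:ℝ) 1, volume E = 0 →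
      scVarMeasure (fun a b => suppFn x' (Φ a b)) E = 0)
    (hpos : ∀ (x' : X →L[ℝ] ℝ) (a b : ℝ), 0 ≤ a → a ≤ b → b ≤ 1 → 0 ≤ suppFn x' (Φ a b)) :
    ∃ M : Set ℝ → Set X,
      -- `M` takes values in `cwk(X)` on the Lebesgue measurable subsets of `[0,1]`,
      (∀ A : Set ℝ, A ⊆ Icc (0:ℝ) 1 → NullMeasurableSet A volume → IsCWK X (M A)) ∧
      -- `M` extends `Φ`,
      (∀ a b : ℝ, 0 ≤ a → a ≤ b → b ≤ 1 → M (Icc a b) = Φ a b) ∧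
      -- `M` is a multimeasure: each `A ↦ σ(x*, M(A))` is countably additive,
      (∀ (x' : X →L[ℝ] ℝ) (A : ℕ → Set ℝ), (∀ k, A k ⊆ Icc (0:ℝ) 1) →
        (∀ k, NullMeasurableSet (A k) volume) → Pairwise (Function.onFun Disjoint A) →
        HasSum (fun k => suppFn x' (M (A k))) (suppFn x' (M (⋃ k, A k)))) ∧
      -- and `M ≪ λ`.
      (∀ A : Set ℝ, A ⊆ Icc (0:ℝ) 1 → volume A = 0 → M A = {0}) := by
  choose f hfc hf using fun x' : X →L[ℝ] ℝ =>
    exists_stieltjesFunction (Ψ := fun a b => suppFn x' (Φ a b))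
      (fun a b c ha hab hbc hc => by
        rw [hadd a b c ha hab hbc hc]
        exact (hcwk a b ha hab (hbc.trans hc)).suppFn_add_set
          (hcwk b c (ha.trans hab) hbc hc) x')
      (hpos x') fun t ht => hvar x' {t} (singleton_subset_iff.2 ht) (by simp)
  have hsub : ∀ x' a b, 0 ≤ a → a ≤ b → b ≤ 1 → suppFn x' (Φ a b) = f x' b - f x' a := by
    intro x' a b ha hab hb
    rw [hf, hf, projIcc_of_mem _ ⟨ha, hab.trans hb⟩, projIcc_of_mem _ ⟨ha.trans hab, hb⟩,
      hadd 0 a b le_rfl ha hab hb, (hcwk 0 a le_rfl ha (hab.trans hb)).suppFn_add_set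
        (hcwk a b ha hab hb)]
    ring
  let ν : (X →L[ℝ] ℝ) → Measure ℝ := fun x' => (f x').measure.restrict (Icc 0 1)
  have hfin : ∀ x', IsFiniteMeasure (ν x') := fun x' =>
    isFiniteMeasure_restrict.2 isCompact_Icc.measure_lt_top.ne
  have hν : ∀ x' {A : Set ℝ}, A ⊆ Icc 0 1 → ν x' A = (f x').measure A :=
    fun x' A hA => Measure.restrict_eq_self _ hA
  have hac : ∀ x', ν x' ≪ volume := fun x' =>
    Measure.AbsolutelyContinuous.mk fun A hA hA0 => by
      rw [Measure.restrict_apply hA]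
      exact measure_eq_zero_of_scVarMeasure_eq_zero (f x') (hfc x') (hsub x') inter_subset_right
        (hvar x' _ inter_subset_right (measure_mono_null inter_subset_left hA0))
  have hIcc : ∀ x' a b, 0 ≤ a → a ≤ b → b ≤ 1 →
      (ν x').real (Icc a b) = suppFn x' (Φ a b) := by
    intro x' a b ha hab hb
    rw [Measure.real, hν x' (Icc_subset_Icc ha hb), StieltjesFunction.measure_Icc,
      (hfc x').continuousAt.continuousWithinAt.leftLim_eq, ← hsub x' a b ha hab hb,
      ENNReal.toReal_ofReal (hpos x' a b ha hab hb)]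
  have hproj : ∀ {s t : ℝ}, s ≤ t → ∃ a b : ℝ, 0 ≤ a ∧ a ≤ b ∧ b ≤ 1 ∧
      ∀ x', suppFn x' (Φ a b) = f x' t - f x' s := by
    intro s t hst
    let a := projIcc (0 : ℝ) 1 zero_le_one s
    let b := projIcc (0 : ℝ) 1 zero_le_one t
    have hab : a ≤ b := monotone_projIcc _ hst
    refine ⟨a, b, a.2.1, hab, b.2.2, fun x' => ?_⟩
    rw [hsub x' a b a.2.1 hab b.2.2]
    simp only [hf, a, b, projIcc_val]
  have hνadd : ∀ x' y', ν (x' + y') ≤ ν x' + ν y' := by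
    intro x' y'
    simp only [ν]
    rw [← Measure.restrict_add, ← StieltjesFunction.measure_add]
    refine Measure.restrict_mono le_rfl (stieltjes_measure_le_of_monotone_sub fun s t hst => ?_)
    obtain ⟨a, b, ha, hab, hb, h⟩ := hproj hst
    have := (hcwk a b ha hab hb).suppFn_add_le x' y'
    simp only [h] at this
    simp only [StieltjesFunction.add_apply]
    linarith
  have hνsmul : ∀ (c : ℝ≥0) x', ν ((c : ℝ) • x') = c • ν x' := by
    intro c x'
    simp only [ν]
    rw [← Measure.restrict_smul, ← StieltjesFunction.measure_smul]
    congr 2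
    ext t
    rw [hf, suppFn_smul c.coe_nonneg, ← hf]
    rfl
  have hK := hcwk 0 1 le_rfl zero_le_one le_rfl
  have hM : ∀ A : Set ℝ, A ⊆ Icc 0 1 →
      IsCWK X {x | ∀ x' : X →L[ℝ] ℝ, x' x ≤ (ν x').real A} ∧
        ∀ x', suppFn x' {x | ∀ x' : X →L[ℝ] ℝ, x' x ≤ (ν x').real A} = (ν x').real A := by
    intro A hA
    refine hK.of_sublinear_le (fun x' => (ν x').real A) (fun x' => measureReal_nonneg)
      (fun x' => ?_) (fun x' y' => ?_) fun c hc x' => ?_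
    · rw [← hIcc x' 0 1 le_rfl zero_le_one le_rfl]
      exact measureReal_mono hA
    · rw [← measureReal_add_apply]
      exact ENNReal.toReal_mono (measure_ne_top _ _) (hνadd x' y' A)
    · lift c to ℝ≥0 using hc
      simp only [hνsmul]
      exact measureReal_nnreal_smul_apply c
  refine ⟨fun A => {x | ∀ x' : X →L[ℝ] ℝ, x' x ≤ (ν x').real A}, fun A hA _ => (hM A hA).1,
    fun a b ha hab hb => ?_, fun x' A hA hAm hAd => ?_, fun A hA hA0 => ?_⟩
  · simp only [hIcc _ a b ha hab hb]
    exact (hcwk a b ha hab hb).eq_setOf_le_suppFn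
  · rw [(hM _ (iUnion_subset hA)).2]
    simp only [fun k => (hM _ (hA k)).2]
    have h := measure_iUnion₀ (μ := ν x') (fun i j hij => (hAd hij).aedisjoint)
      fun k => (hAm k).mono_ac (hac x')
    have hs : ∑' k, ν x' (A k) ≠ ∞ := h ▸ measure_ne_top _ _
    simp only [Measure.real, h]
    rw [ENNReal.tsum_toReal_eq fun k => measure_ne_top _ _]
    exact (ENNReal.summable_toReal hs).hasSum
  · have hz : ∀ x', (ν x').real A = 0 := fun x' => by simp [Measure.real, hac x' hA0]
    simp only [hz]
    ext x
    refine ⟨fun hx => ?_, fun hx x' => by simp [mem_singleton_iff.1 hx]⟩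
    refine (SeparatingDual.eq_zero_iff_forall_dual_eq_zero (R := ℝ) x).2 fun g =>
      le_antisymm (hx g) ?_
    simpa using hx (-g)

end GaugePaper
end
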